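/- arXiv:1111.5404 — 4 statements merged into one kernel-verified Lean document; each statement's English description precedes it below -/
import Mathlib

section
/- Let ψ : ℕ → ℝ be any function defined on the positive integers such that ψ(n) → ∞ as n → ∞. Then B(n) ≤ n^{τ(n)·ψ(n)} for almost all n; that is, the set of n for which this inequality fails has asymptotic density 0 (i.e., #{n ≤ x : B(n) > n^{τ(n)ψ(n)}}/x → 0 as x → ∞). -/
open Polynomial Filter
open scoped Classical

/-- Height of an integer polynomial: max absolute value of coefficients. -/
def polyHeight (f : Polynomial ℤ) : ℕ := f.support.sup fun i => (f.coeff i).natAbs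

/-- A(n): height of the n-th cyclotomic polynomial. -/
noncomputable def A (n : ℕ) : ℕ := polyHeight (Polynomial.cyclotomic n ℤ)

/-- B(n): max height over all integer polynomial divisors of x^n - 1. -/
noncomputable def B (n : ℕ) : ℕ :=
  sSup {h : ℕ | ∃ f : Polynomial ℤ, f ∣ (Polynomial.X ^ n - 1) ∧ polyHeight f = h}

/-- A₀(n): max of A(d) over positive divisors d of n. -/
noncomputable def A0 (n : ℕ) : ℕ := n.divisors.sup A

/-- τ(n): number of positive divisors of n. -/
def tau (n : ℕ) : ℕ := n.divisors.card

/-- ω(n): number of distinct prime factors of n. -/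
def omegaCount (n : ℕ) : ℕ := n.primeFactors.card

/-- p_k(n): the k-th largest distinct prime factor of n (1-indexed), or 1 if k > ω(n). -/
def pk (n k : ℕ) : ℕ :=
  if k ≤ n.primeFactors.card then
    (n.primeFactors.sort (· ≤ ·)).getD (n.primeFactors.card - k) 1
  else 1

/-- ω([t,x],n): number of distinct prime factors of n lying in the real interval [t,x]. -/
noncomputable def omegaInterval (t x : ℝ) (n : ℕ) : ℕ :=
  (n.primeFactors.filter fun p : ℕ => t ≤ (p : ℝ) ∧ (p : ℝ) ≤ x).card

/-- rad(n): the radical (product of the distinct prime factors) of n. -/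
def rad (n : ℕ) : ℕ := ∏ p ∈ n.primeFactors, p

/-- The sum of the absolute values of the coefficients of an integer polynomial. -/
def coeffSum (f : Polynomial ℤ) : ℕ := ∑ i ∈ f.support, (f.coeff i).natAbs

theorem polyHeight_le_coeffSum (f : Polynomial ℤ) : polyHeight f ≤ coeffSum f :=
  Finset.sup_le fun _ hi =>
    Finset.single_le_sum (f := fun i => (f.coeff i).natAbs) (fun _ _ => Nat.zero_le _) hi

theorem coeffSum_eq_of_support_subset {f : Polynomial ℤ} {s : Finset ℕ} (h : f.support ⊆ s) :
    coeffSum f = ∑ i ∈ s, (f.coeff i).natAbs :=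
  Finset.sum_subset h fun i _ hi => by simp [notMem_support_iff.mp hi]

theorem coeffSum_zero : coeffSum 0 = 0 := by simp [coeffSum]

theorem coeffSum_one : coeffSum 1 = 1 := by
  have h : coeffSum 1 = ∑ i ∈ {0}, ((1 : Polynomial ℤ).coeff i).natAbs :=
    coeffSum_eq_of_support_subset fun i hi => by
      by_contra h0
      simp [coeff_one] at hi h0
      omega
  simp [h]

theorem coeffSum_neg (f : Polynomial ℤ) : coeffSum (-f) = coeffSum f := by
  simp [coeffSum]

theorem coeffSum_add_le (f g : Polynomial ℤ) : coeffSum (f + g) ≤ coeffSum f + coeffSum g := by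
  rw [coeffSum_eq_of_support_subset (support_add (p := f) (q := g)),
    coeffSum_eq_of_support_subset (f := f) (s := f.support ∪ g.support) Finset.subset_union_left,
    coeffSum_eq_of_support_subset (f := g) (s := f.support ∪ g.support) Finset.subset_union_right,
    ← Finset.sum_add_distrib]
  exact Finset.sum_le_sum fun i _ => by rw [coeff_add]; exact Int.natAbs_add_le _ _

theorem coeffSum_sum_le {ι : Type*} (s : Finset ι) (f : ι → Polynomial ℤ) :
    coeffSum (∑ i ∈ s, f i) ≤ ∑ i ∈ s, coeffSum (f i) :=
  Finset.le_sum_of_subadditive coeffSum coeffSum_zero.le coeffSum_add_le s f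

theorem coeffSum_C_mul_X_pow_mul_le (a : ℤ) (n : ℕ) (g : Polynomial ℤ) :
    coeffSum (C a * X ^ n * g) ≤ a.natAbs * coeffSum g := by
  have hc (d : ℕ) : (C a * X ^ n * g).coeff (d + n) = a * g.coeff d := by
    rw [mul_assoc, coeff_C_mul, coeff_X_pow_mul]
  have hs : (C a * X ^ n * g).support ⊆ g.support.image (· + n) := by
    intro k hk
    rw [mem_support_iff, mul_assoc, coeff_C_mul, coeff_X_pow_mul'] at hk
    split_ifs at hk with h
    · exact Finset.mem_image.mpr
        ⟨k - n, mem_support_iff.mpr (right_ne_zero_of_mul hk), Nat.sub_add_cancel h⟩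
    · simp at hk
  rw [coeffSum_eq_of_support_subset hs, Finset.sum_image (by intro _ _ _ _ h; simpa using h),
    coeffSum, Finset.mul_sum]
  exact Finset.sum_le_sum fun d _ => by rw [hc, Int.natAbs_mul]

theorem coeffSum_mul_le (f g : Polynomial ℤ) : coeffSum (f * g) ≤ coeffSum f * coeffSum g := by
  conv_lhs => rw [f.as_sum_support_C_mul_X_pow, Finset.sum_mul]
  refine (coeffSum_sum_le _ _).trans ?_
  rw [coeffSum, Finset.sum_mul]
  exact Finset.sum_le_sum fun i _ => coeffSum_C_mul_X_pow_mul_le _ _ _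

theorem coeffSum_expand {p : ℕ} (hp : 0 < p) (f : Polynomial ℤ) :
    coeffSum (expand ℤ p f) = coeffSum f := by
  have hs : (expand ℤ p f).support ⊆ f.support.image (· * p) := by
    intro k hk
    rw [mem_support_iff, coeff_expand hp] at hk
    split_ifs at hk with h
    · exact Finset.mem_image.mpr ⟨k / p, mem_support_iff.mpr hk, Nat.div_mul_cancel h⟩
    · simp at hk
  rw [coeffSum_eq_of_support_subset hs,
    Finset.sum_image (by intro _ _ _ _ h; exact Nat.eq_of_mul_eq_mul_right hp h), coeffSum]
  exact Finset.sum_congr rfl fun d _ => by rw [coeff_expand_mul hp]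

theorem coeffSum_of_isUnit {f : Polynomial ℤ} (hf : IsUnit f) : coeffSum f = 1 := by
  obtain ⟨r, hr, rfl⟩ := isUnit_iff.mp hf
  rcases Int.isUnit_iff.mp hr with rfl | rfl
  · simp [coeffSum_one]
  · simp [coeffSum_neg, coeffSum_one]

theorem coeffSum_le_of_dvd_irreducible {f g : Polynomial ℤ} (hg : Irreducible g) (h : f ∣ g)
    {M : ℕ} (hM : 1 ≤ M) (hgM : coeffSum g ≤ M) : coeffSum f ≤ M := by
  rcases hg.dvd_iff.mp h with hu | ha
  · rwa [coeffSum_of_isUnit hu]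
  · obtain ⟨u, rfl⟩ := ha
    refine (coeffSum_mul_le _ _).trans ?_
    rwa [coeffSum_of_isUnit u.isUnit, mul_one]

theorem coeffSum_le_of_dvd_prod {ι : Type*} (s : Finset ι) (g : ι → Polynomial ℤ) {M : ℕ}
    (hM : 1 ≤ M) (hg : ∀ i ∈ s, Irreducible (g i)) (hgM : ∀ i ∈ s, coeffSum (g i) ≤ M)
    {f : Polynomial ℤ} (hf : f ∣ ∏ i ∈ s, g i) : coeffSum f ≤ M ^ s.card := by
  induction s using Finset.induction_on generalizing f with
  | empty => simpa using (coeffSum_of_isUnit (isUnit_of_dvd_one (by simpa using hf))).le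
  | insert a s ha ih =>
    rw [Finset.prod_insert ha] at hf
    obtain ⟨f₁, f₂, h₁, h₂, rfl⟩ := exists_dvd_and_dvd_of_dvd_mul hf
    rw [Finset.card_insert_of_notMem ha, pow_succ']
    exact (coeffSum_mul_le _ _).trans (Nat.mul_le_mul
      (coeffSum_le_of_dvd_irreducible (hg a (by simp)) h₁ hM (hgM a (by simp)))
      (ih (fun i hi => hg i (by simp [hi])) (fun i hi => hgM i (by simp [hi])) h₂))

theorem natAbs_coeff_le_of_mul_X_pow_sub_one {g h : Polynomial ℤ} {m : ℕ} (hm : 0 < m)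
    (hgh : g * (X ^ m - 1) = h) (k : ℕ) : (g.coeff k).natAbs ≤ (k / m + 1) * coeffSum h := by
  have hh (i : ℕ) : (h.coeff i).natAbs ≤ coeffSum h := by
    by_cases hi : i ∈ h.support
    · exact Finset.single_le_sum (f := fun i => (h.coeff i).natAbs) (fun _ _ => Nat.zero_le _) hi
    · simp [notMem_support_iff.mp hi]
  induction k using Nat.strong_induction_on with
  | _ k ih =>
    have hk : h.coeff k = (if m ≤ k then g.coeff (k - m) else 0) - g.coeff k := by
      rw [← hgh, mul_sub, mul_one, coeff_sub, coeff_mul_X_pow']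
    have := hh k
    split_ifs at hk with hmk
    · have h1 := ih (k - m) (by omega)
      have h2 : k / m = (k - m) / m + 1 := by
        rw [Nat.div_eq_sub_div hm hmk]
      rw [h2, add_mul _ 1, one_mul]
      omega
    · have : coeffSum h ≤ (k / m + 1) * coeffSum h := Nat.le_mul_of_pos_left _ (Nat.succ_pos _)
      omega

/-- The product of the elements `p` of `s`, each raised to the power `2 ^ j`, where `j` is the
number of elements of `s` above `p`. -/
def doublingWeight (s : Finset ℕ) : ℕ := ∏ p ∈ s, p ^ 2 ^ (s.filter (p < ·)).card

theorem doublingWeight_insert {s : Finset ℕ} {p : ℕ} (h : ∀ q ∈ s, q < p) :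
    doublingWeight (insert p s) = doublingWeight s ^ 2 * p := by
  have hp : p ∉ s := fun hp => (h p hp).false
  rw [doublingWeight, Finset.prod_insert hp, mul_comm, doublingWeight, ← Finset.prod_pow]
  congr 1
  · refine Finset.prod_congr rfl fun q hq => ?_
    rw [Finset.filter_insert, if_pos (h q hq), Finset.card_insert_of_notMem (by simp [hp]),
      pow_succ, pow_mul]
  · rw [Finset.filter_eq_empty_iff.mpr]
    · simp
    · intro q hq
      rcases Finset.mem_insert.mp hq with rfl | hq
      · exact lt_irrefl _
      · exact (h q hq).not_gt

theorem doublingWeight_mono {s t : Finset ℕ} (hst : s ⊆ t) (ht : ∀ p ∈ t, 0 < p) :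
    doublingWeight s ≤ doublingWeight t := by
  calc doublingWeight s ≤ ∏ p ∈ s, p ^ 2 ^ (t.filter (p < ·)).card :=
        Finset.prod_le_prod' fun p hp => Nat.pow_le_pow_right (ht p (hst hp))
          (Nat.pow_le_pow_right two_pos (Finset.card_le_card (Finset.filter_subset_filter _ hst)))
    _ ≤ doublingWeight t :=
        Finset.prod_le_prod_of_subset_of_one_le' hst fun p hp _ => Nat.pos_of_ne_zero
          (pow_ne_zero _ (ht p hp).ne')

theorem coeffSum_cyclotomic_mul_prime_le {m p : ℕ} (hm : 0 < m) (hp : p.Prime) (hpm : ¬ p ∣ m)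
    {g : Polynomial ℤ} (hg : cyclotomic m ℤ * g = X ^ m - 1) :
    coeffSum (cyclotomic (m * p) ℤ) ≤ m * p * p * (coeffSum (cyclotomic m ℤ) * coeffSum g) := by
  have hexp := cyclotomic_expand_eq_cyclotomic_mul hp hpm ℤ
  have hrec : cyclotomic (m * p) ℤ * (X ^ m - 1) = expand ℤ p (cyclotomic m ℤ) * g := by
    rw [← hg, hexp, mul_assoc]
  have hsum : coeffSum (expand ℤ p (cyclotomic m ℤ) * g) ≤
      coeffSum (cyclotomic m ℤ) * coeffSum g := by
    simpa [coeffSum_expand hp.pos] using coeffSum_mul_le (expand ℤ p (cyclotomic m ℤ)) g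
  have hsupp : (cyclotomic (m * p) ℤ).support ⊆ Finset.range (m * p) := by
    intro k hk
    have h1 := le_natDegree_of_mem_supp k hk
    rw [natDegree_cyclotomic] at h1
    exact Finset.mem_range.mpr
      (h1.trans_lt (Nat.totient_lt _ (hp.one_lt.trans_le (Nat.le_mul_of_pos_left p hm))))
  rw [coeffSum_eq_of_support_subset hsupp]
  calc ∑ k ∈ Finset.range (m * p), ((cyclotomic (m * p) ℤ).coeff k).natAbs
      ≤ ∑ k ∈ Finset.range (m * p), p * (coeffSum (cyclotomic m ℤ) * coeffSum g) := by
        refine Finset.sum_le_sum fun k hk => ?_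
        refine (natAbs_coeff_le_of_mul_X_pow_sub_one hm hrec k).trans (Nat.mul_le_mul ?_ hsum)
        exact Nat.div_lt_of_lt_mul (Finset.mem_range.mp hk)
    _ = _ := by rw [Finset.sum_const, Finset.card_range, smul_eq_mul]; ring

theorem coeffSum_cyclotomic_prod_le (s : Finset ℕ) (hs : ∀ p ∈ s, p.Prime) :
    coeffSum (cyclotomic (∏ p ∈ s, p) ℤ) * (∏ p ∈ s, p) ^ 2 ≤ 2 * doublingWeight s ^ 5 ∧
    ∃ g, cyclotomic (∏ p ∈ s, p) ℤ * g = X ^ (∏ p ∈ s, p) - 1 ∧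
      coeffSum g * (∏ p ∈ s, p) ^ 2 ≤ 2 * doublingWeight s ^ 5 := by
  induction s using Finset.induction_on_max with
  | empty =>
    have h : coeffSum (X - 1) ≤ 2 := by
      have h1 := coeffSum_add_le X (-1)
      have h2 := coeffSum_C_mul_X_pow_mul_le 1 1 1
      simp only [coeffSum_neg, coeffSum_one, map_one, pow_one, one_mul, mul_one, Int.natAbs_one,
        ← sub_eq_add_neg] at h1 h2
      omega
    simpa [doublingWeight, h] using ⟨1, by simp [coeffSum_one]⟩
  | insert p s hlt ih =>
    obtain ⟨ha, g, hg, hb⟩ := ih fun q hq => hs q (by simp [hq])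
    have hp : p.Prime := hs p (by simp)
    have hps : p ∉ s := fun h => (hlt p h).false
    have hpm : ¬ p ∣ ∏ q ∈ s, q := fun h => by
      obtain ⟨q, hq, hpq⟩ := (hp.prime.dvd_finsetProd_iff _).mp h
      exact (hlt q hq).ne' ((Nat.prime_dvd_prime_iff_eq hp (hs q (by simp [hq]))).mp hpq)
    have hm : 0 < ∏ q ∈ s, q := Finset.prod_pos fun q hq => (hs q (by simp [hq])).pos
    rw [doublingWeight_insert hlt, Finset.prod_insert hps, mul_comm p]
    have hc := coeffSum_cyclotomic_mul_prime_le hm hp hpm hg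
    have hexp := cyclotomic_expand_eq_cyclotomic_mul hp hpm ℤ
    have hd := coeffSum_mul_le (expand ℤ p g) (cyclotomic (∏ q ∈ s, q) ℤ)
    rw [coeffSum_expand hp.pos] at hd
    have hgp : cyclotomic ((∏ q ∈ s, q) * p) ℤ *
        (expand ℤ p g * cyclotomic (∏ q ∈ s, q) ℤ) = X ^ ((∏ q ∈ s, q) * p) - 1 := by
      have := congrArg (expand ℤ p) hg
      rw [map_mul, hexp, map_sub, map_pow, expand_X, map_one, ← pow_mul, mul_comm p] at this
      rw [← this]; ring
    generalize coeffSum (cyclotomic (∏ q ∈ s, q) ℤ) = a at *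
    generalize coeffSum g = b at *
    generalize (∏ q ∈ s, q) = m at *
    generalize doublingWeight s = W at *
    have key : p ^ 4 * ((a * m ^ 2) * (b * m ^ 2)) ≤ 2 * (W ^ 2 * p) ^ 5 := by
      calc p ^ 4 * ((a * m ^ 2) * (b * m ^ 2)) ≤ p ^ 4 * ((2 * W ^ 5) * (2 * W ^ 5)) := by gcongr
        _ = 2 * (W ^ 10 * p ^ 4 * 2) := by ring
        _ ≤ 2 * (W ^ 10 * p ^ 4 * p) := by gcongr; exact hp.two_le
        _ = _ := by ring
    refine ⟨?_, _, hgp, ?_⟩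
    · calc _ ≤ m * p * p * (a * b) * (m * p) ^ 2 := by gcongr
        _ = p ^ 4 * ((a * m ^ 2) * (b * m)) := by ring
        _ ≤ p ^ 4 * ((a * m ^ 2) * (b * m ^ 2)) := by
          gcongr
          exact Nat.le_self_pow two_ne_zero m
        _ ≤ _ := key
    · calc _ ≤ b * a * (m * p) ^ 2 := by gcongr
        _ = p ^ 2 * ((a * m ^ 2) * (b * 1)) := by ring
        _ ≤ p ^ 4 * ((a * m ^ 2) * (b * m ^ 2)) := by
          gcongr
          · exact hp.pos
          · norm_num
          · exact Nat.one_le_pow _ _ hm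
        _ ≤ _ := key

theorem coeffSum_cyclotomic_le {n : ℕ} (hn : n ≠ 0) :
    coeffSum (cyclotomic n ℤ) ≤ 2 * doublingWeight n.primeFactors ^ 5 := by
  induction n using Nat.strong_induction_on with
  | _ n ih =>
    by_cases hsq : Squarefree n
    · have h := (coeffSum_cyclotomic_prod_le n.primeFactors
        fun p hp => Nat.prime_of_mem_primeFactors hp).1
      rw [Nat.prod_primeFactors_of_squarefree hsq] at h
      exact (Nat.le_mul_of_pos_right _ (pow_pos (Nat.pos_of_ne_zero hn) 2)).trans h
    · rw [Nat.squarefree_iff_prime_squarefree] at hsq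
      push Not at hsq
      obtain ⟨p, hp, k, rfl⟩ := hsq
      have hk : k ≠ 0 := right_ne_zero_of_mul hn
      have hpk : p * k ≠ 0 := mul_ne_zero hp.ne_zero hk
      have h := ih (p * k) (by
        rw [mul_assoc]
        exact lt_mul_left (Nat.pos_of_ne_zero hpk) hp.one_lt) hpk
      have hpf : (p * p * k).primeFactors = (p * k).primeFactors := by
        rw [mul_assoc, Nat.primeFactors_mul hp.ne_zero hpk, Nat.primeFactors_mul hp.ne_zero hk,
          ← Finset.union_assoc, Finset.union_self]
      rw [hpf]
      rwa [← coeffSum_expand hp.pos, cyclotomic_expand_eq_cyclotomic hp (dvd_mul_right p k),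
        mul_comm, ← mul_assoc] at h

theorem B_le_pow_tau {n : ℕ} (hn : n ≠ 0) :
    B n ≤ (2 * doublingWeight n.primeFactors ^ 5) ^ tau n := by
  refine csSup_le ⟨_, 1, one_dvd _, rfl⟩ ?_
  rintro _ ⟨f, hf, rfl⟩
  rw [← prod_cyclotomic_eq_X_pow_sub_one (Nat.pos_of_ne_zero hn)] at hf
  have hpos : 0 < doublingWeight n.primeFactors :=
    Finset.prod_pos fun p hp => pow_pos (Nat.prime_of_mem_primeFactors hp).pos _
  refine (polyHeight_le_coeffSum f).trans
    (coeffSum_le_of_dvd_prod _ _ (Nat.mul_pos two_pos (pow_pos hpos 5)) ?_ ?_ hf)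
  · exact fun d hd => cyclotomic.irreducible (Nat.pos_of_mem_divisors hd)
  · intro d hd
    refine (coeffSum_cyclotomic_le (Nat.pos_of_mem_divisors hd).ne').trans ?_
    gcongr
    exact doublingWeight_mono (Nat.primeFactors_mono (Nat.dvd_of_mem_divisors hd) hn)
      fun p hp => (Nat.prime_of_mem_primeFactors hp).pos

/-- The primes `p` with `a < p ≤ b`. -/
def primesIoc (a b : ℕ) : Finset ℕ := (Finset.Ioc a b).filter Nat.Prime

theorem mem_primesIoc {a b p : ℕ} : p ∈ primesIoc a b ↔ (a < p ∧ p ≤ b) ∧ p.Prime := by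
  simp [primesIoc]

theorem sum_primesIoc_consecutive (f : ℕ → ℝ) {a b c : ℕ} (hab : a ≤ b) (hbc : b ≤ c) :
    ∑ p ∈ primesIoc a b, f p + ∑ p ∈ primesIoc b c, f p = ∑ p ∈ primesIoc a c, f p := by
  simp only [primesIoc, Finset.sum_filter]
  exact Finset.sum_Ioc_consecutive _ hab hbc

theorem prod_primesIoc_consecutive (f : ℕ → ℝ) {a b c : ℕ} (hab : a ≤ b) (hbc : b ≤ c) :
    (∏ p ∈ primesIoc a b, f p) * ∏ p ∈ primesIoc b c, f p = ∏ p ∈ primesIoc a c, f p := by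
  simp only [primesIoc, Finset.prod_filter]
  exact Finset.prod_Ioc_consecutive _ hab hbc

theorem log_factorial_eq_sum_primesIoc (n : ℕ) :
    Real.log (n.factorial : ℝ) =
      ∑ p ∈ primesIoc 0 n, (n.factorial.factorization p : ℝ) * Real.log p := by
  rw [Real.log_nat_eq_sum_factorization, Finsupp.sum]
  refine Finset.sum_subset (fun p hp => ?_) fun p _ hp => ?_
  · have hpp : p.Prime := Nat.prime_of_mem_primeFactors hp
    exact mem_primesIoc.mpr
      ⟨⟨hpp.pos, hpp.dvd_factorial.mp (Nat.dvd_of_mem_primeFactors hp)⟩, hpp⟩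
  · simp [Finsupp.notMem_support_iff.mp hp]

theorem sum_log_div_primes_le {n : ℕ} (hn : 0 < n) :
    ∑ p ∈ primesIoc 0 n, Real.log p / p ≤ Real.log n + Real.log 4 := by
  have hn' : (0 : ℝ) < n := Nat.cast_pos.mpr hn
  have h1 : Real.log (n.factorial : ℝ) ≤ n * Real.log n := by
    rw [← Real.log_pow]
    exact Real.log_le_log (by positivity) (by exact_mod_cast Nat.factorial_le_pow n)
  have h2 : ∑ p ∈ primesIoc 0 n, Real.log p ≤ Real.log 4 * n := by
    have := Chebyshev.theta_le_log4_mul_x hn'.le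
    rwa [Chebyshev.theta, Nat.floor_natCast] at this
  have h3 : ∑ p ∈ primesIoc 0 n, ((n : ℝ) / p - 1) * Real.log p ≤
      Real.log (n.factorial : ℝ) := by
    rw [log_factorial_eq_sum_primesIoc]
    refine Finset.sum_le_sum fun p hp => ?_
    obtain ⟨⟨-, hpn⟩, hpp⟩ := mem_primesIoc.mp hp
    refine mul_le_mul_of_nonneg_right ?_ (Real.log_nonneg (by exact_mod_cast hpp.one_le))
    have h4 : n / p ≤ n.factorial.factorization p := by
      rw [Nat.factorization_factorial hpp (Nat.lt_succ_self _)]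
      have h5 : 1 ∈ Finset.Ico 1 (Nat.log p n).succ :=
        Finset.mem_Ico.mpr ⟨le_rfl, Nat.succ_lt_succ (Nat.log_pos hpp.one_lt hpn)⟩
      simpa using Finset.single_le_sum (f := fun i => n / p ^ i) (fun _ _ => Nat.zero_le _) h5
    have h6 : (n : ℝ) / p < (n / p : ℕ) + 1 := by
      rw [← Nat.floor_div_eq_div (K := ℝ)]
      exact Nat.lt_floor_add_one _
    have h7 : ((n / p : ℕ) : ℝ) ≤ n.factorial.factorization p := by exact_mod_cast h4
    linarith
  have h8 : ∑ p ∈ primesIoc 0 n, ((n : ℝ) / p - 1) * Real.log p =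
      n * ∑ p ∈ primesIoc 0 n, Real.log p / p - ∑ p ∈ primesIoc 0 n, Real.log p := by
    rw [Finset.mul_sum, ← Finset.sum_sub_distrib]
    exact Finset.sum_congr rfl fun p _ => by ring
  have : n * ∑ p ∈ primesIoc 0 n, Real.log p / p ≤ n * (Real.log n + Real.log 4) := by
    linarith
  exact le_of_mul_le_mul_left this hn'

theorem exists_log_le_sum_log_div_primes :
    ∃ D : ℝ, ∀ n : ℕ, 0 < n → Real.log n ≤ ∑ p ∈ primesIoc 0 n, Real.log p / p + D := by
  have hsum : Summable fun k : ℕ => 4 * ((k : ℝ) ^ (3 / 2 : ℝ))⁻¹ :=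
    (Real.summable_nat_rpow_inv.mpr (by norm_num)).mul_left 4
  refine ⟨1 + ∑' k : ℕ, 4 * ((k : ℝ) ^ (3 / 2 : ℝ))⁻¹, fun n hn => ?_⟩
  have hn' : (0 : ℝ) < n := Nat.cast_pos.mpr hn
  have h1 : n * Real.log n - n ≤ Real.log (n.factorial : ℝ) := by
    have h := Real.log_le_log (by positivity) (Real.pow_div_factorial_le_exp n hn'.le n)
    rw [Real.log_exp, Real.log_div (by positivity) (by positivity), Real.log_pow] at h
    linarith
  have h2 : Real.log (n.factorial : ℝ) ≤
      n * ∑ p ∈ primesIoc 0 n, (Real.log p / p + 4 * ((p : ℝ) ^ (3 / 2 : ℝ))⁻¹) := by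
    rw [log_factorial_eq_sum_primesIoc, Finset.mul_sum]
    refine Finset.sum_le_sum fun p hp => ?_
    have hpp := (mem_primesIoc.mp hp).2
    have hp2 : (2 : ℝ) ≤ p := by exact_mod_cast hpp.two_le
    have hp0 : (0 : ℝ) < p := by linarith
    have hlog : 0 ≤ Real.log p := Real.log_nonneg (by linarith)
    have h3 : (n.factorial.factorization p : ℝ) ≤ n / (p - 1) := by
      calc (n.factorial.factorization p : ℝ) ≤ (n / (p - 1) : ℕ) := by
            exact_mod_cast Nat.factorization_factorial_le_div_pred hpp n
        _ ≤ (n : ℝ) / (p - 1 : ℕ) := Nat.cast_div_le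
        _ = _ := by rw [Nat.cast_pred hpp.pos]
    have h4 : Real.log p ≤ 2 * (p : ℝ) ^ (1 / 2 : ℝ) := by
      have := Real.log_le_rpow_div hp0.le (show (0 : ℝ) < 1 / 2 by norm_num)
      linarith
    have h5 : (p : ℝ) ^ (1 / 2 : ℝ) = p ^ 2 * ((p : ℝ) ^ (3 / 2 : ℝ))⁻¹ := by
      rw [← Real.rpow_neg hp0.le, ← Real.rpow_natCast, ← Real.rpow_add hp0]
      norm_num
    have h6 : Real.log p / (p - 1) ≤ Real.log p / p + 4 * ((p : ℝ) ^ (3 / 2 : ℝ))⁻¹ := by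
      have h7 : Real.log p / (p - 1) - Real.log p / p = Real.log p / (p * (p - 1)) := by
        field_simp [show (p : ℝ) - 1 ≠ 0 by linarith]
        ring
      have h8 : Real.log p / (p * (p - 1)) ≤ 4 * ((p : ℝ) ^ (3 / 2 : ℝ))⁻¹ := by
        rw [div_le_iff₀ (by nlinarith)]
        have h9 : 0 ≤ ((p : ℝ) ^ (3 / 2 : ℝ))⁻¹ := by positivity
        rw [h5] at h4
        nlinarith [mul_nonneg h9 (show (0 : ℝ) ≤ p * (p - 2) by nlinarith)]
      linarith
    calc _ ≤ (n : ℝ) / (p - 1) * Real.log p := mul_le_mul_of_nonneg_right h3 hlog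
      _ = n * (Real.log p / (p - 1)) := by ring
      _ ≤ _ := mul_le_mul_of_nonneg_left h6 hn'.le
  have h10 : ∑ p ∈ primesIoc 0 n, 4 * ((p : ℝ) ^ (3 / 2 : ℝ))⁻¹ ≤
      ∑' k : ℕ, 4 * ((k : ℝ) ^ (3 / 2 : ℝ))⁻¹ :=
    hsum.sum_le_tsum _ fun k _ => by positivity
  rw [Finset.sum_add_distrib] at h2
  have : n * (Real.log n - 1) ≤ n * (∑ p ∈ primesIoc 0 n, Real.log p / p +
      ∑ p ∈ primesIoc 0 n, 4 * ((p : ℝ) ^ (3 / 2 : ℝ))⁻¹) := by linarith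
  have := le_of_mul_le_mul_left this hn'
  linarith

theorem eventually_exists_sum_inv_primes_le :
    ∃ N : ℕ, ∀ x ≥ N, ∃ y < x, Real.log y ≤ 5 / 6 * Real.log x ∧
      ∑ p ∈ primesIoc y x, (1 : ℝ) / p ≤ 41 / 200 := by
  obtain ⟨D, hD⟩ := exists_log_le_sum_log_div_primes
  have hlim : Tendsto (fun x : ℕ => Real.log (x : ℝ)) atTop atTop :=
    Real.tendsto_log_atTop.comp tendsto_natCast_atTop_atTop
  obtain ⟨N, hN⟩ := eventually_atTop.mp
    ((hlim.eventually_ge_atTop (240 * (Real.log 4 + D + Real.log 2))).and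
      (eventually_ge_atTop 2))
  refine ⟨N, fun x hx => ?_⟩
  obtain ⟨hlarge, hx2⟩ := hN x hx
  have hx2' : (2 : ℝ) ≤ x := by exact_mod_cast hx2
  have hx0 : (0 : ℝ) < x := by linarith
  have hlx : 0 < Real.log x := Real.log_pos (by linarith)
  set r : ℝ := (x : ℝ) ^ (5 / 6 : ℝ) with hr
  have hr1 : 1 ≤ r := Real.one_le_rpow (by linarith) (by norm_num)
  have hrx : r < x := by
    conv_rhs => rw [← Real.rpow_one (x : ℝ)]
    exact Real.rpow_lt_rpow_of_exponent_lt (by linarith) (by norm_num)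
  have hlr : Real.log r = 5 / 6 * Real.log x := Real.log_rpow hx0 _
  have hy1 : 1 ≤ ⌊r⌋₊ := Nat.le_floor (by simpa using hr1)
  have hy1' : (1 : ℝ) ≤ ⌊r⌋₊ := by exact_mod_cast hy1
  have hyr : (⌊r⌋₊ : ℝ) ≤ r := Nat.floor_le (by linarith)
  have hry : r < ⌊r⌋₊ + 1 := Nat.lt_floor_add_one r
  have hyx : ⌊r⌋₊ < x := by exact_mod_cast hyr.trans_lt hrx
  have hly : Real.log r - Real.log 2 ≤ Real.log ⌊r⌋₊ := by
    rw [← Real.log_div (by linarith) (by norm_num)]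
    exact Real.log_le_log (by linarith) (by linarith)
  refine ⟨⌊r⌋₊, hyx, ?_, ?_⟩
  · rw [← hlr]
    exact Real.log_le_log (by linarith) hyr
  · have h1 := sum_primesIoc_consecutive (fun p => Real.log p / p) (Nat.zero_le ⌊r⌋₊) hyx.le
    have h2 := sum_log_div_primes_le (show 0 < x by omega)
    have h3 := hD _ hy1
    have h4 : (5 / 6 * Real.log x) * ∑ p ∈ primesIoc ⌊r⌋₊ x, (1 : ℝ) / p ≤
        ∑ p ∈ primesIoc ⌊r⌋₊ x, Real.log p / p := by
      rw [Finset.mul_sum]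
      refine Finset.sum_le_sum fun p hp => ?_
      obtain ⟨⟨hyp, -⟩, hpp⟩ := mem_primesIoc.mp hp
      have hrp : r ≤ p := hry.le.trans (by exact_mod_cast hyp)
      rw [← hlr, mul_one_div]
      gcongr
    have h5 : (5 / 6 * Real.log x) * ∑ p ∈ primesIoc ⌊r⌋₊ x, (1 : ℝ) / p ≤
        (5 / 6 * Real.log x) * (41 / 200) := by
      linarith
    exact le_of_mul_le_mul_left h5 (by positivity)

theorem card_filter_dvd_le {x p : ℕ} {T : Finset ℕ} (hp : p.Prime) (hT : ∀ q ∈ T, q.Prime)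
    (hpT : p ∉ T) :
    (((Finset.Ioc 0 x).filter fun n => p ∣ n ∧ ∀ q ∈ T, q ∣ n).card : ℝ) ≤
      x / p * ∏ q ∈ T, (1 / (q : ℝ)) := by
  have hsub : ((Finset.Ioc 0 x).filter fun n => p ∣ n ∧ ∀ q ∈ T, q ∣ n) ⊆
      (Finset.Ioc 0 x).filter fun n => (∏ q ∈ insert p T, q) ∣ n := by
    refine Finset.monotone_filter_right _ fun n _ hn => Finset.prod_primes_dvd n ?_ ?_
    · intro q hq
      rcases Finset.mem_insert.mp hq with rfl | hq
      exacts [hp.prime, (hT q hq).prime]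
    · intro q hq
      rcases Finset.mem_insert.mp hq with rfl | hq
      exacts [hn.1, hn.2 q hq]
  calc _ ≤ (((Finset.Ioc 0 x).filter fun n => (∏ q ∈ insert p T, q) ∣ n).card : ℝ) := by
        exact_mod_cast Finset.card_le_card hsub
    _ = ((x / ∏ q ∈ insert p T, q : ℕ) : ℝ) := by rw [Nat.Ioc_filter_dvd_card_eq_div]
    _ ≤ (x : ℝ) / (∏ q ∈ insert p T, q : ℕ) := Nat.cast_div_le
    _ = _ := by
      rw [Finset.prod_insert hpT, Nat.cast_mul, Nat.cast_prod, Finset.prod_div_distrib,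
        Finset.prod_const_one]
      field_simp

theorem sum_pow_card_primeFactors_gt_le {w : ℝ} (hw : 0 ≤ w) {x p : ℕ} (hp : p.Prime) :
    ∑ n ∈ (Finset.Ioc 0 x).filter (p ∣ ·), (1 + w) ^ (n.primeFactors.filter (p < ·)).card ≤
      x / p * ∏ q ∈ primesIoc p x, (1 + w / q) := by
  have hpow {n : ℕ} (hn : n ∈ (Finset.Ioc 0 x).filter (p ∣ ·)) :
      (1 + w) ^ (n.primeFactors.filter (p < ·)).card =
        ∑ T ∈ (primesIoc p x).powerset, if ∀ q ∈ T, q ∣ n then w ^ T.card else 0 := by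
    obtain ⟨hn1, -⟩ := Finset.mem_filter.mp hn
    obtain ⟨hn0, hnx⟩ := Finset.mem_Ioc.mp hn1
    have hset : n.primeFactors.filter (p < ·) = (primesIoc p x).filter (· ∣ n) := by
      ext q
      simp only [Finset.mem_filter, Nat.mem_primeFactors, mem_primesIoc]
      constructor
      · rintro ⟨⟨hq, hqn, -⟩, hpq⟩
        exact ⟨⟨⟨hpq, (Nat.le_of_dvd hn0 hqn).trans hnx⟩, hq⟩, hqn⟩
      · rintro ⟨⟨⟨hpq, -⟩, hq⟩, hqn⟩
        exact ⟨⟨hq, hqn, hn0.ne'⟩, hpq⟩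
    calc (1 + w) ^ (n.primeFactors.filter (p < ·)).card
        = ∏ q ∈ primesIoc p x, (1 + if q ∣ n then w else 0) := by
          rw [hset, ← Finset.prod_const, Finset.prod_filter]
          exact Finset.prod_congr rfl fun q _ => by split_ifs <;> simp
      _ = _ := by
          rw [Finset.prod_one_add]
          refine Finset.sum_congr rfl fun T _ => ?_
          split_ifs with h
          · rw [← Finset.prod_const]
            exact Finset.prod_congr rfl fun q hq => if_pos (h q hq)
          · push Not at h
            obtain ⟨q, hq, hqn⟩ := h
            exact Finset.prod_eq_zero hq (if_neg hqn)
  rw [Finset.sum_congr rfl fun n hn => hpow hn, Finset.sum_comm, Finset.prod_one_add,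
    Finset.mul_sum]
  refine Finset.sum_le_sum fun T hT => ?_
  have hT' := Finset.mem_powerset.mp hT
  rw [← Finset.sum_filter, Finset.filter_filter, Finset.sum_const, nsmul_eq_mul]
  have hcard := card_filter_dvd_le (x := x) hp (fun q hq => (mem_primesIoc.mp (hT' hq)).2)
    (fun hpT => (mem_primesIoc.mp (hT' hpT)).1.1.false)
  calc _ ≤ x / p * (∏ q ∈ T, (1 / (q : ℝ))) * w ^ T.card :=
        mul_le_mul_of_nonneg_right hcard (pow_nonneg hw _)
    _ = _ := by
      rw [mul_assoc, ← Finset.prod_const, ← Finset.prod_mul_distrib]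
      congr 1
      exact Finset.prod_congr rfl fun q _ => by ring

/-- The sum over primes `p ≤ x` that bounds the mean of `√(log (doublingWeight n.primeFactors))`
over `n ≤ x`, with `√2 - 1` in place of `w`. -/
noncomputable def weightMean (w : ℝ) (x : ℕ) : ℝ :=
  ∑ p ∈ primesIoc 0 x, √(Real.log p) / p * ∏ q ∈ primesIoc p x, (1 + w / q)

theorem sqrt_log_doublingWeight_le {n : ℕ} :
    √(Real.log (doublingWeight n.primeFactors)) ≤ ∑ p ∈ n.primeFactors,
      √(Real.log p) * (1 + (√2 - 1)) ^ (n.primeFactors.filter (p < ·)).card := by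
  have hlog {p : ℕ} (hp : p ∈ n.primeFactors) : 0 ≤ Real.log p :=
    Real.log_nonneg (by exact_mod_cast (Nat.prime_of_mem_primeFactors hp).one_le)
  rw [add_sub_cancel]
  refine Real.sqrt_le_iff.mpr ⟨Finset.sum_nonneg fun p _ => by positivity, ?_⟩
  refine le_trans (le_of_eq ?_) (Finset.sum_sq_le_sq_sum_of_nonneg fun p _ => by positivity)
  rw [doublingWeight, Nat.cast_prod, Real.log_prod]
  · refine Finset.sum_congr rfl fun p hp => ?_
    rw [mul_pow, Real.sq_sqrt (hlog hp), pow_right_comm, Real.sq_sqrt (by norm_num), Nat.cast_pow,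
      Real.log_pow]
    push_cast
    ring
  · intro p hp
    have := (Nat.prime_of_mem_primeFactors hp).ne_zero
    positivity

theorem sum_sqrt_log_doublingWeight_le (x : ℕ) :
    ∑ n ∈ Finset.Ioc 0 x, √(Real.log (doublingWeight n.primeFactors)) ≤
      x * weightMean (√2 - 1) x := by
  have hw : 0 ≤ √2 - 1 := sub_nonneg.mpr (Real.one_le_sqrt.mpr one_le_two)
  calc _ ≤ ∑ n ∈ Finset.Ioc 0 x, ∑ p ∈ n.primeFactors,
        √(Real.log p) * (1 + (√2 - 1)) ^ (n.primeFactors.filter (p < ·)).card :=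
        Finset.sum_le_sum fun n _ => sqrt_log_doublingWeight_le
    _ = ∑ p ∈ primesIoc 0 x, ∑ n ∈ (Finset.Ioc 0 x).filter (p ∣ ·),
        √(Real.log p) * (1 + (√2 - 1)) ^ (n.primeFactors.filter (p < ·)).card := by
        refine Finset.sum_comm' fun n p => ?_
        simp only [Finset.mem_filter, Finset.mem_Ioc, Nat.mem_primeFactors, mem_primesIoc]
        constructor
        · rintro ⟨⟨hn0, hnx⟩, hp, hpn, -⟩
          exact ⟨⟨⟨hn0, hnx⟩, hpn⟩, ⟨hp.pos, (Nat.le_of_dvd hn0 hpn).trans hnx⟩, hp⟩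
        · rintro ⟨⟨⟨hn0, hnx⟩, hpn⟩, -, hp⟩
          exact ⟨⟨hn0, hnx⟩, hp, hpn, hn0.ne'⟩
    _ ≤ _ := by
        rw [weightMean, Finset.mul_sum]
        refine Finset.sum_le_sum fun p hp => ?_
        rw [← Finset.mul_sum]
        refine (mul_le_mul_of_nonneg_left (sum_pow_card_primeFactors_gt_le hw
          (mem_primesIoc.mp hp).2) (Real.sqrt_nonneg _)).trans (le_of_eq ?_)
        ring

theorem weightMean_le_of_sum_inv_le {w K : ℝ} (hw : 0 ≤ w) {x y : ℕ} (hyx : y ≤ x)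
    (hK : ∑ p ∈ primesIoc y x, (1 : ℝ) / p ≤ K) :
    weightMean w x ≤ Real.exp (w * K) * (weightMean w y + K * √(Real.log x)) := by
  have hone (q : ℕ) : (1 : ℝ) ≤ 1 + w / q := le_add_of_nonneg_right (by positivity)
  have hexp : ∏ q ∈ primesIoc y x, (1 + w / q) ≤ Real.exp (w * K) := by
    refine (Real.prod_one_add_le_exp_sum _ fun q => by positivity).trans
      (Real.exp_le_exp.mpr ?_)
    calc ∑ q ∈ primesIoc y x, w / q = w * ∑ q ∈ primesIoc y x, (1 : ℝ) / q := by
          rw [Finset.mul_sum]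
          exact Finset.sum_congr rfl fun q _ => by ring
      _ ≤ w * K := mul_le_mul_of_nonneg_left hK hw
  rw [weightMean, ← sum_primesIoc_consecutive _ (Nat.zero_le y) hyx, mul_add]
  refine add_le_add ?_ ?_
  · rw [weightMean, Finset.mul_sum]
    refine Finset.sum_le_sum fun p hp => ?_
    rw [← prod_primesIoc_consecutive _ (mem_primesIoc.mp hp).1.2 hyx, ← mul_assoc, mul_comm]
    exact mul_le_mul_of_nonneg_right hexp
      (mul_nonneg (by positivity) (Finset.prod_nonneg fun q _ => zero_le_one.trans (hone q)))
  · calc _ ≤ ∑ p ∈ primesIoc y x, √(Real.log x) * (1 / p) * Real.exp (w * K) := by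
          refine Finset.sum_le_sum fun p hp => ?_
          obtain ⟨⟨hyp, hpx⟩, hpp⟩ := mem_primesIoc.mp hp
          have hp0 : (0 : ℝ) < p := by exact_mod_cast hpp.pos
          rw [div_eq_mul_one_div]
          refine mul_le_mul ?_ (le_trans ?_ hexp)
            (Finset.prod_nonneg fun q _ => zero_le_one.trans (hone q)) (by positivity)
          · gcongr
          · refine Finset.prod_le_prod_of_subset_of_one_le ?_ ?_ ?_
            · intro q hq
              obtain ⟨⟨hpq, hqx⟩, hqp⟩ := mem_primesIoc.mp hq
              exact mem_primesIoc.mpr ⟨⟨hyp.trans hpq, hqx⟩, hqp⟩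
            · exact fun q _ => zero_le_one.trans (hone q)
            · exact fun q _ _ => hone q
      _ = Real.exp (w * K) * √(Real.log x) * ∑ p ∈ primesIoc y x, (1 : ℝ) / p := by
          rw [Finset.mul_sum]
          exact Finset.sum_congr rfl fun q _ => by ring
      _ ≤ Real.exp (w * K) * √(Real.log x) * K := mul_le_mul_of_nonneg_left hK (by positivity)
      _ = _ := by ring

theorem weightMean_nonneg {w : ℝ} (hw : 0 ≤ w) (x : ℕ) : 0 ≤ weightMean w x :=
  Finset.sum_nonneg fun p _ => mul_nonneg (by positivity)
    (Finset.prod_nonneg fun q _ => by positivity)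

theorem weightMean_eq_zero {w : ℝ} {x : ℕ} (hx : x < 2) : weightMean w x = 0 := by
  have h : primesIoc 0 x = ∅ := Finset.eq_empty_of_forall_notMem fun p hp => by
    obtain ⟨⟨-, hpx⟩, hpp⟩ := mem_primesIoc.mp hp
    have := hpp.two_le
    omega
  rw [weightMean, h, Finset.sum_empty]

theorem exp_sqrt_two_sub_one_mul_sqrt_lt_one :
    Real.exp ((√2 - 1) * (41 / 200)) * √(5 / 6) < 1 := by
  have h2 : √2 ≤ 1.4143 := Real.sqrt_le_iff.mpr ⟨by norm_num, by norm_num⟩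
  have h3 : √(5 / 6) ≤ 0.913 := Real.sqrt_le_iff.mpr ⟨by norm_num, by norm_num⟩
  have h4 : Real.exp ((√2 - 1) * (41 / 200)) ≤ 1.094 := by
    refine (Real.exp_le_exp.mpr (show _ ≤ (0.085 : ℝ) by linarith)).trans
      ((Real.exp_bound_div_one_sub_of_interval (by norm_num) (by norm_num)).trans (by norm_num))
  nlinarith [Real.exp_pos ((√2 - 1) * (41 / 200)), Real.sqrt_nonneg (5 / 6)]

theorem exists_weightMean_le :
    ∃ C : ℝ, ∀ x : ℕ, weightMean (√2 - 1) x ≤ C * √(Real.log x) := by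
  have hw : 0 ≤ √2 - 1 := sub_nonneg.mpr (Real.one_le_sqrt.mpr one_le_two)
  obtain ⟨N, hN⟩ := eventually_exists_sum_inv_primes_le
  set E := Real.exp ((√2 - 1) * (41 / 200)) with hE
  have hE0 : 0 < E := Real.exp_pos _
  have hlt : E * √(5 / 6) < 1 := exp_sqrt_two_sub_one_mul_sqrt_lt_one
  set C₁ := E * (41 / 200) / (1 - E * √(5 / 6)) with hC₁
  set C₂ := (∑ k ∈ Finset.range N, weightMean (√2 - 1) k) / √(Real.log 2) with hC₂
  have hl2 : 0 < √(Real.log 2) := Real.sqrt_pos.mpr (Real.log_pos one_lt_two)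
  have hC₂0 : 0 ≤ C₂ := div_nonneg (Finset.sum_nonneg fun k _ => weightMean_nonneg hw k) hl2.le
  refine ⟨max C₁ C₂, fun x => ?_⟩
  have hC0 : 0 ≤ max C₁ C₂ := hC₂0.trans (le_max_right _ _)
  induction x using Nat.strong_induction_on with
  | _ x ih =>
    rcases lt_or_ge x 2 with hx2 | hx2
    · rw [weightMean_eq_zero hx2]
      positivity
    rcases lt_or_ge x N with hxN | hxN
    · have h1 : weightMean (√2 - 1) x ≤ ∑ k ∈ Finset.range N, weightMean (√2 - 1) k :=
        Finset.single_le_sum (fun k _ => weightMean_nonneg hw k) (Finset.mem_range.mpr hxN)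
      calc _ ≤ C₂ * √(Real.log 2) := by rwa [hC₂, div_mul_cancel₀ _ hl2.ne']
        _ ≤ max C₁ C₂ * √(Real.log x) := by
          gcongr
          · exact le_max_right _ _
          · exact_mod_cast hx2
    · obtain ⟨y, hyx, hly, hsum⟩ := hN x hxN
      have hy : √(Real.log y) ≤ √(5 / 6) * √(Real.log x) := by
        rw [← Real.sqrt_mul (by norm_num)]
        exact Real.sqrt_le_sqrt hly
      have hC : E * (41 / 200) ≤ max C₁ C₂ * (1 - E * √(5 / 6)) :=
        (div_le_iff₀ (sub_pos.mpr hlt)).mp (le_max_left C₁ C₂)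
      calc weightMean (√2 - 1) x
          ≤ E * (weightMean (√2 - 1) y + 41 / 200 * √(Real.log x)) :=
            weightMean_le_of_sum_inv_le hw hyx.le hsum
        _ ≤ E * (max C₁ C₂ * (√(5 / 6) * √(Real.log x)) + 41 / 200 * √(Real.log x)) := by
            gcongr
            exact (ih y hyx).trans (mul_le_mul_of_nonneg_left hy hC0)
        _ = (max C₁ C₂ * (E * √(5 / 6)) + E * (41 / 200)) * √(Real.log x) := by ring
        _ ≤ max C₁ C₂ * √(Real.log x) := by
            refine mul_le_mul_of_nonneg_right ?_ (Real.sqrt_nonneg _)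
            linarith

theorem mul_log_lt_of_rpow_lt_B {n : ℕ} (hn : 2 ≤ n) {t : ℝ}
    (h : (n : ℝ) ^ ((tau n : ℝ) * t) < B n) :
    (t - 1) * Real.log n < 5 * Real.log (doublingWeight n.primeFactors) := by
  have hn0 : (0 : ℝ) < n := by positivity
  have hW : (0 : ℝ) < doublingWeight n.primeFactors := by
    exact_mod_cast Finset.prod_pos fun p hp =>
      pow_pos (Nat.prime_of_mem_primeFactors hp).pos _
  have hB : (B n : ℝ) ≤ (2 * (doublingWeight n.primeFactors : ℝ) ^ 5) ^ tau n := by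
    exact_mod_cast B_le_pow_tau (by omega)
  have h1 := Real.log_lt_log (by positivity) (h.trans_le hB)
  rw [Real.log_rpow hn0, Real.log_pow, mul_assoc] at h1
  have h2 := lt_of_mul_lt_mul_left h1 (Nat.cast_nonneg _)
  rw [Real.log_mul (by norm_num) (by positivity), Real.log_pow] at h2
  have h3 : Real.log 2 ≤ Real.log n := Real.log_le_log (by norm_num) (by exact_mod_cast hn)
  push_cast at h2
  linarith

theorem card_filter_sqrt_log_doublingWeight_gt_le {C U : ℝ} (hU : 0 < U) {x : ℕ} (hx : 2 ≤ x)
    (hC : weightMean (√2 - 1) x ≤ C * √(Real.log x)) :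
    (((Finset.Ioc 0 x).filter fun n =>
      U * √(Real.log x) < √(Real.log (doublingWeight n.primeFactors))).card : ℝ) ≤ C / U * x := by
  have hlx : 0 < √(Real.log x) := Real.sqrt_pos.mpr (Real.log_pos (by exact_mod_cast hx))
  have h1 := Finset.card_nsmul_le_sum ((Finset.Ioc 0 x).filter fun n =>
      U * √(Real.log x) < √(Real.log (doublingWeight n.primeFactors)))
    (fun n => √(Real.log (doublingWeight n.primeFactors))) (U * √(Real.log x))
    fun n hn => (Finset.mem_filter.mp hn).2.le
  have h2 := Finset.sum_le_sum_of_subset_of_nonneg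
    (f := fun n : ℕ => √(Real.log (doublingWeight n.primeFactors)))
    (Finset.filter_subset (fun n =>
      U * √(Real.log x) < √(Real.log (doublingWeight n.primeFactors))) (Finset.Ioc 0 x))
    fun n _ _ => Real.sqrt_nonneg _
  have h3 := sum_sqrt_log_doublingWeight_le x
  have h4 : (x : ℝ) * weightMean (√2 - 1) x ≤ x * (C * √(Real.log x)) :=
    mul_le_mul_of_nonneg_left hC (Nat.cast_nonneg _)
  rw [nsmul_eq_mul] at h1
  refine le_of_mul_le_mul_right ?_ (mul_pos hU hlx)
  calc _ ≤ x * (C * √(Real.log x)) := ((h1.trans h2).trans h3).trans h4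
    _ = _ := by field_simp

theorem sqrt_log_doublingWeight_gt {n x : ℕ} {t U : ℝ} (hU : 0 < U) (hn : 2 ≤ n)
    (hnx : x < n ^ 2) (ht : 10 * U ^ 2 + 1 ≤ t) (h : (n : ℝ) ^ ((tau n : ℝ) * t) < B n) :
    U * √(Real.log x) < √(Real.log (doublingWeight n.primeFactors)) := by
  have h1 := mul_log_lt_of_rpow_lt_B hn h
  have hln : 0 < Real.log n := Real.log_pos (by exact_mod_cast hn)
  have hlx : Real.log x ≤ 2 * Real.log n := by
    rcases Nat.eq_zero_or_pos x with rfl | hx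
    · simpa using hln.le
    · have h2 : Real.log x ≤ Real.log ((n : ℝ) ^ 2) :=
        Real.log_le_log (by exact_mod_cast hx) (by exact_mod_cast hnx.le)
      rw [Real.log_pow] at h2
      exact_mod_cast h2
  have h3 : 10 * U ^ 2 * Real.log n ≤ (t - 1) * Real.log n :=
    mul_le_mul_of_nonneg_right (by linarith) hln.le
  have h4 : U ^ 2 * Real.log x ≤ U ^ 2 * (2 * Real.log n) :=
    mul_le_mul_of_nonneg_left hlx (sq_nonneg U)
  calc U * √(Real.log x) = √(U ^ 2 * Real.log x) := by
        rw [Real.sqrt_mul (sq_nonneg U), Real.sqrt_sq hU.le]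
    _ < _ := Real.sqrt_lt_sqrt (mul_nonneg (sq_nonneg U) (Real.log_natCast_nonneg x))
        (by linarith)

/-- If ψ(n) → ∞ then B(n) ≤ n^{τ(n)ψ(n)} for almost all n. -/
theorem maximal_height_divisors_bound (ψ : ℕ → ℝ)
    (hψ : Tendsto ψ atTop atTop) :
    Tendsto (fun x : ℕ =>
        (((Finset.Icc 1 x).filter
          (fun n => (B n : ℝ) > (n : ℝ) ^ ((tau n : ℝ) * ψ n))).card : ℝ) / (x : ℝ))
      atTop (nhds 0) := by
  obtain ⟨C, hC⟩ := exists_weightMean_le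
  have hC0 : 0 ≤ C := by
    have h := (weightMean_nonneg (sub_nonneg.mpr (Real.one_le_sqrt.mpr one_le_two)) 2).trans (hC 2)
    exact nonneg_of_mul_nonneg_left h (Real.sqrt_pos.mpr (Real.log_pos (by norm_num)))
  rw [Metric.tendsto_atTop]
  intro ε hε
  set U := 4 * (C + 1) / ε with hU
  have hU0 : 0 < U := by positivity
  obtain ⟨N, hN⟩ := eventually_atTop.mp (hψ.eventually_ge_atTop (10 * U ^ 2 + 1))
  have hsqrt : Tendsto (fun x : ℕ => √(x : ℝ)) atTop atTop :=
    Real.tendsto_sqrt_atTop.comp tendsto_natCast_atTop_atTop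
  obtain ⟨X, hX⟩ := eventually_atTop.mp
    ((hsqrt.eventually_ge_atTop (4 * (N + 3) / ε)).and (eventually_ge_atTop 2))
  refine ⟨X, fun x hx => ?_⟩
  obtain ⟨hlarge, hx2⟩ := hX x hx
  have hx0 : (0 : ℝ) < x := by positivity
  have hsub : (Finset.Icc 1 x).filter
      (fun n => (B n : ℝ) > (n : ℝ) ^ ((tau n : ℝ) * ψ n)) ⊆
      (Finset.Ioc 0 (N + 1) ∪ Finset.Ioc 0 (Nat.sqrt x)) ∪ (Finset.Ioc 0 x).filter fun n =>
        U * √(Real.log x) < √(Real.log (doublingWeight n.primeFactors)) := by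
    intro n hn
    obtain ⟨hn1, hbad⟩ := Finset.mem_filter.mp hn
    obtain ⟨hn0, hnx⟩ := Finset.mem_Icc.mp hn1
    simp only [Finset.mem_union, Finset.mem_Ioc, Finset.mem_filter]
    by_contra! hcon
    have hnN : N + 1 < n := lt_of_not_ge fun h => (hcon.1.1 hn0).not_ge h
    have hns : Nat.sqrt x < n := lt_of_not_ge fun h => (hcon.1.2 hn0).not_ge h
    exact (hcon.2 ⟨hn0, hnx⟩).not_gt (sqrt_log_doublingWeight_gt hU0 (by omega)
      (Nat.sqrt_lt'.mp hns) (hN n (by omega)) hbad)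
  have hcard := (Finset.card_le_card hsub).trans ((Finset.card_union_le _ _).trans
    (Nat.add_le_add_right (Finset.card_union_le _ _) _))
  rw [Nat.card_Ioc, Nat.card_Ioc, Nat.sub_zero, Nat.sub_zero] at hcard
  have hcard' := (Nat.cast_le (α := ℝ)).mpr hcard
  push_cast at hcard'
  have hmarkov := card_filter_sqrt_log_doublingWeight_gt_le hU0 hx2 (hC x)
  have hns : (Nat.sqrt x : ℝ) ≤ √(x : ℝ) := Real.nat_sqrt_le_real_sqrt
  have hs1 : 1 ≤ √(x : ℝ) := Real.one_le_sqrt.mpr (by exact_mod_cast (by omega : 1 ≤ x))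
  have hCU : C / U * x ≤ ε / 4 * x := by
    refine mul_le_mul_of_nonneg_right ?_ hx0.le
    rw [hU, div_le_iff₀ (by positivity)]
    field_simp
    linarith
  have hsmall : (N : ℝ) + 1 + √(x : ℝ) ≤ ε / 4 * x := by
    rw [div_le_iff₀ hε] at hlarge
    have h1 := mul_le_mul_of_nonneg_right hlarge (Real.sqrt_nonneg (x : ℝ))
    have h2 := Real.mul_self_sqrt hx0.le
    nlinarith [mul_nonneg (Nat.cast_nonneg (α := ℝ) N) (sub_nonneg.mpr hs1)]
  rw [Real.dist_eq, sub_zero, abs_of_nonneg (by positivity), div_lt_iff₀ hx0]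
  have : 0 < ε * x := mul_pos hε hx0
  linarith
end

section
/- Let ψ : ℕ → ℝ be any function defined on the positive integers such that ψ(n) → ∞ as n → ∞. Then A(n) ≤ n^{ψ(n)} for almost all n; that is, the set of n for which this inequality fails has asymptotic density 0 (i.e., #{n ≤ x : A(n) > n^{ψ(n)}}/x → 0 as x → ∞). -/
open Polynomial Filter
open scoped Classical

/-- The sum of the absolute values of the coefficients of an integer polynomial. -/
noncomputable def coeffAbsSum (f : ℤ[X]) : ℤ := ∑ i ∈ f.support, |f.coeff i|

lemma coeffAbsSum_eq_sum_of_subset {f : ℤ[X]} {s : Finset ℕ} (h : f.support ⊆ s) :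
    coeffAbsSum f = ∑ i ∈ s, |f.coeff i| :=
  Finset.sum_subset h fun i _ hi => by simp [notMem_support_iff.mp hi]

lemma sum_abs_coeff_le_coeffAbsSum (f : ℤ[X]) (s : Finset ℕ) :
    ∑ i ∈ s, |f.coeff i| ≤ coeffAbsSum f := by
  rw [coeffAbsSum_eq_sum_of_subset (Finset.subset_union_left (s₂ := s))]
  exact Finset.sum_le_sum_of_subset_of_nonneg Finset.subset_union_right fun _ _ _ => abs_nonneg _

lemma coeffAbsSum_nonneg (f : ℤ[X]) : 0 ≤ coeffAbsSum f :=
  Finset.sum_nonneg fun _ _ => abs_nonneg _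

lemma abs_coeff_le_coeffAbsSum (f : ℤ[X]) (i : ℕ) : |f.coeff i| ≤ coeffAbsSum f := by
  simpa using sum_abs_coeff_le_coeffAbsSum f {i}

lemma coeffAbsSum_add_le (f g : ℤ[X]) :
    coeffAbsSum (f + g) ≤ coeffAbsSum f + coeffAbsSum g := by
  calc coeffAbsSum (f + g) ≤ ∑ i ∈ (f + g).support, (|f.coeff i| + |g.coeff i|) :=
        Finset.sum_le_sum fun i _ => by rw [coeff_add]; exact abs_add_le _ _
    _ ≤ _ := by
        rw [Finset.sum_add_distrib]
        exact add_le_add (sum_abs_coeff_le_coeffAbsSum f _) (sum_abs_coeff_le_coeffAbsSum g _)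

lemma coeffAbsSum_monomial_mul_le (n : ℕ) (a : ℤ) (g : ℤ[X]) :
    coeffAbsSum (monomial n a * g) ≤ |a| * coeffAbsSum g := by
  have hcoeff (i : ℕ) :
      (monomial n a * g).coeff i = if n ≤ i then a * g.coeff (i - n) else 0 := by
    rw [← C_mul_X_pow_eq_monomial, mul_right_comm, coeff_mul_X_pow', coeff_C_mul]
  have hsub : (monomial n a * g).support ⊆ g.support.map (addRightEmbedding n) := by
    intro i hi
    rw [mem_support_iff, hcoeff] at hi
    split_ifs at hi with h
    · exact Finset.mem_map.mpr ⟨i - n, mem_support_iff.mpr (right_ne_zero_of_mul hi),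
        Nat.sub_add_cancel h⟩
    · exact absurd rfl hi
  rw [coeffAbsSum_eq_sum_of_subset hsub, Finset.sum_map, coeffAbsSum, Finset.mul_sum]
  exact Finset.sum_le_sum fun i _ => by simp [hcoeff, abs_mul]

lemma coeffAbsSum_mul_le (f g : ℤ[X]) :
    coeffAbsSum (f * g) ≤ coeffAbsSum f * coeffAbsSum g := by
  conv_lhs => rw [f.as_sum_support, Finset.sum_mul]
  refine (Finset.le_sum_of_subadditive coeffAbsSum (by simp [coeffAbsSum])
    coeffAbsSum_add_le _ _).trans ?_
  rw [coeffAbsSum, Finset.sum_mul]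
  exact Finset.sum_le_sum fun i _ => coeffAbsSum_monomial_mul_le _ _ _

lemma coeffAbsSum_expand_le {p : ℕ} (hp : 0 < p) (f : ℤ[X]) :
    coeffAbsSum (expand ℤ p f) ≤ coeffAbsSum f := by
  have hsub : (expand ℤ p f).support ⊆ f.support.image (· * p) := by
    intro i hi
    rw [mem_support_iff, coeff_expand hp] at hi
    split_ifs at hi with h
    · exact Finset.mem_image.mpr ⟨i / p, mem_support_iff.mpr hi, Nat.div_mul_cancel h⟩
    · exact absurd rfl hi
  rw [coeffAbsSum_eq_sum_of_subset hsub, Finset.sum_image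
    fun a _ b _ h => Nat.eq_of_mul_eq_mul_right hp h]
  exact Finset.sum_le_sum fun i _ => by rw [coeff_expand_mul hp]

lemma coeffAbsSum_le_natDegree_succ_mul {f : ℤ[X]} {M : ℤ} (h : ∀ i, |f.coeff i| ≤ M) :
    coeffAbsSum f ≤ (f.natDegree + 1) * M := by
  rw [coeffAbsSum_eq_sum_of_subset supp_subset_range_natDegree_succ]
  simpa using Finset.sum_le_card_nsmul (Finset.range (f.natDegree + 1)) _ M fun i _ => h i

lemma abs_coeff_le_of_mul_X_pow_sub_one {f : ℤ[X]} {m : ℕ} (hm : 0 < m) (j : ℕ) :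
    |f.coeff j| ≤ coeffAbsSum (f * (X ^ m - 1)) := by
  set g := f * (X ^ m - 1) with hg
  refine le_trans ?_ (sum_abs_coeff_le_coeffAbsSum g (Finset.range (j + 1)))
  induction j using Nat.strong_induction_on with
  | _ j ih =>
    have hcoeff : g.coeff j = (if m ≤ j then f.coeff (j - m) else 0) - f.coeff j := by
      rw [hg, mul_sub, mul_one, coeff_sub, coeff_mul_X_pow']
    rw [Finset.sum_range_succ]
    split_ifs at hcoeff with h
    · have h1 := ih (j - m) (by omega)
      have h2 : ∑ i ∈ Finset.range (j - m + 1), |g.coeff i| ≤ ∑ i ∈ Finset.range j, |g.coeff i| :=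
        Finset.sum_le_sum_of_subset_of_nonneg
          (Finset.range_subset_range.mpr (by omega)) fun _ _ _ => abs_nonneg _
      have h3 : f.coeff j = f.coeff (j - m) - g.coeff j := by rw [hcoeff]; ring
      rw [h3]
      exact (abs_sub _ _).trans (by linarith)
    · have h3 : f.coeff j = - g.coeff j := by rw [hcoeff]; ring
      rw [h3, abs_neg]
      exact le_add_of_nonneg_left (Finset.sum_nonneg fun _ _ => abs_nonneg _)

/-- The sum over `p ∈ S` of `log p`, weighted by two to the number of larger elements of `S`. -/
noncomputable def weightedLogSum (S : Finset ℕ) : ℝ :=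
  ∑ p ∈ S, 2 ^ (S.filter (p < ·)).card * Real.log p

lemma weightedLogSum_nonneg (S : Finset ℕ) : 0 ≤ weightedLogSum S :=
  Finset.sum_nonneg fun p _ => mul_nonneg (by positivity) (Real.log_natCast_nonneg p)

lemma weightedLogSum_insert_of_forall_lt {S : Finset ℕ} {p : ℕ} (h : ∀ q ∈ S, q < p) :
    weightedLogSum (insert p S) = 2 * weightedLogSum S + Real.log p := by
  have hp : p ∉ S := fun hp => lt_irrefl _ (h p hp)
  have h0 : (insert p S).filter (p < ·) = ∅ := by
    ext q
    simp only [Finset.mem_filter, Finset.mem_insert, Finset.notMem_empty, iff_false]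
    rintro ⟨rfl | hq, h'⟩
    · exact lt_irrefl _ h'
    · exact lt_asymm h' (h q hq)
  have h1 : ∀ q ∈ S, ((insert p S).filter (q < ·)).card = (S.filter (q < ·)).card + 1 := by
    intro q hq
    rw [Finset.filter_insert, if_pos (h q hq), Finset.card_insert_of_notMem (by simp [hp])]
  rw [weightedLogSum, Finset.sum_insert hp, h0, weightedLogSum, Finset.mul_sum, add_comm]
  congr 1
  · exact Finset.sum_congr rfl fun q hq => by rw [h1 q hq, pow_succ]; ring
  · simp

lemma exists_cyclotomic_mul_eq_and_coeffAbsSum_le (S : Finset ℕ) (hS : ∀ p ∈ S, p.Prime) :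
    ∃ Ψ : ℤ[X], cyclotomic (∏ p ∈ S, p) ℤ * Ψ = X ^ (∏ p ∈ S, p) - 1 ∧
      (coeffAbsSum (cyclotomic (∏ p ∈ S, p) ℤ) : ℝ) * (∏ p ∈ S, p : ℕ) ≤
        2 * Real.exp (3 * weightedLogSum S) ∧
      (coeffAbsSum Ψ : ℝ) * (∏ p ∈ S, p : ℕ) ≤ 2 * Real.exp (3 * weightedLogSum S) := by
  induction S using Finset.induction_on_max with
  | empty =>
    have hone : coeffAbsSum 1 ≤ 1 := by
      simpa using coeffAbsSum_le_natDegree_succ_mul (f := 1) (M := 1) fun i => by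
        rw [coeff_one]; split_ifs <;> simp
    refine ⟨1, by simp, ?_, ?_⟩
    · have h := coeffAbsSum_le_natDegree_succ_mul (f := X - 1) (M := 1) fun i => by
        rw [coeff_sub, coeff_X, coeff_one]; split_ifs <;> simp_all
      rw [show (X - 1 : ℤ[X]).natDegree = 1 by simpa using natDegree_X_sub_C (1 : ℤ)] at h
      simp only [Finset.prod_empty, cyclotomic_one, weightedLogSum, Finset.sum_empty]
      norm_num at h ⊢
      exact_mod_cast h
    · simp only [Finset.prod_empty, weightedLogSum, Finset.sum_empty]
      norm_num
      exact_mod_cast hone.trans (by norm_num)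
  | insert p S hlt ih =>
    obtain ⟨Ψ, hmul, hΦ, hΨ⟩ := ih fun q hq => hS q (Finset.mem_insert_of_mem hq)
    have hpS : p ∉ S := fun hp => lt_irrefl _ (hlt p hp)
    have hp : p.Prime := hS p (Finset.mem_insert_self _ _)
    rw [Finset.prod_insert hpS, weightedLogSum_insert_of_forall_lt hlt, mul_comm p]
    set m := ∏ q ∈ S, q with hm
    have hm0 : 0 < m := Finset.prod_pos fun q hq => (hS q (Finset.mem_insert_of_mem hq)).pos
    have hpm : ¬ p ∣ m := by
      rw [hm, hp.prime.dvd_finsetProd_iff]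
      rintro ⟨q, hq, hpq⟩
      exact hpS ((Nat.prime_dvd_prime_iff_eq hp (hS q (Finset.mem_insert_of_mem hq))).mp hpq ▸ hq)
    have hexp := cyclotomic_expand_eq_cyclotomic_mul hp hpm ℤ
    have hprod : coeffAbsSum (expand ℤ p (cyclotomic m ℤ) * Ψ) ≤
        coeffAbsSum (cyclotomic m ℤ) * coeffAbsSum Ψ :=
      (coeffAbsSum_mul_le _ _).trans
        (mul_le_mul_of_nonneg_right (coeffAbsSum_expand_le hp.pos _) (coeffAbsSum_nonneg _))
    have hnew : coeffAbsSum (cyclotomic (m * p) ℤ) ≤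
        (m * p : ℕ) * (coeffAbsSum (cyclotomic m ℤ) * coeffAbsSum Ψ) := by
      refine (coeffAbsSum_le_natDegree_succ_mul fun j =>
        (abs_coeff_le_of_mul_X_pow_sub_one hm0 j).trans ?_).trans
        (mul_le_mul_of_nonneg_right ?_
          (mul_nonneg (coeffAbsSum_nonneg _) (coeffAbsSum_nonneg _)))
      · rwa [← hmul, ← mul_assoc, ← hexp]
      · rw [natDegree_cyclotomic]
        exact_mod_cast Nat.totient_lt _ (lt_of_lt_of_le hp.one_lt (Nat.le_mul_of_pos_left p hm0))
    have hnewΨ : coeffAbsSum (expand ℤ p Ψ * cyclotomic m ℤ) ≤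
        coeffAbsSum (cyclotomic m ℤ) * coeffAbsSum Ψ := by
      rw [mul_comm (coeffAbsSum (cyclotomic m ℤ))]
      exact (coeffAbsSum_mul_le _ _).trans
        (mul_le_mul_of_nonneg_right (coeffAbsSum_expand_le hp.pos _) (coeffAbsSum_nonneg _))
    have hp2 : (2 : ℝ) ≤ p := by exact_mod_cast hp.two_le
    have hm1 : (1 : ℝ) ≤ m := by exact_mod_cast hm0
    have hexp3 : Real.exp (3 * (2 * weightedLogSum S + Real.log p)) =
        Real.exp (3 * weightedLogSum S) ^ 2 * (p : ℝ) ^ 3 := by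
      rw [← Real.exp_log (show (0 : ℝ) < p by linarith), ← Real.exp_nat_mul, ← Real.exp_nat_mul,
        ← Real.exp_add, Real.log_exp]
      congr 1
      push_cast
      ring
    have ha : (0 : ℝ) ≤ coeffAbsSum (cyclotomic m ℤ) := by exact_mod_cast coeffAbsSum_nonneg _
    have hb : (0 : ℝ) ≤ coeffAbsSum Ψ := by exact_mod_cast coeffAbsSum_nonneg _
    have hE := Real.exp_pos (3 * weightedLogSum S)
    have hbound : (m * p : ℝ) * (coeffAbsSum (cyclotomic m ℤ) * coeffAbsSum Ψ) * (m * p) ≤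
        2 * (Real.exp (3 * weightedLogSum S) ^ 2 * (p : ℝ) ^ 3) := by
      calc (m * p : ℝ) * (coeffAbsSum (cyclotomic m ℤ) * coeffAbsSum Ψ) * (m * p)
          = ((coeffAbsSum (cyclotomic m ℤ) * m) * (coeffAbsSum Ψ * m)) * (p : ℝ) ^ 2 := by ring
        _ ≤ ((2 * Real.exp (3 * weightedLogSum S)) * (2 * Real.exp (3 * weightedLogSum S))) *
              (p : ℝ) ^ 2 := by gcongr
        _ = 2 * Real.exp (3 * weightedLogSum S) ^ 2 * (p : ℝ) ^ 2 * 2 := by ring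
        _ ≤ 2 * Real.exp (3 * weightedLogSum S) ^ 2 * (p : ℝ) ^ 2 * p := by gcongr
        _ = _ := by ring
    refine ⟨expand ℤ p Ψ * cyclotomic m ℤ, ?_, ?_, ?_⟩
    · rw [mul_comm (expand ℤ p Ψ), ← mul_assoc, ← hexp, ← map_mul, hmul]
      simp [pow_mul, mul_comm m p]
    · rw [hexp3]
      refine le_trans ?_ hbound
      push_cast
      gcongr
      exact_mod_cast hnew
    · rw [hexp3]
      refine le_trans ?_ hbound
      have h1 : (coeffAbsSum (expand ℤ p Ψ * cyclotomic m ℤ) : ℝ) ≤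
          coeffAbsSum (cyclotomic m ℤ) * coeffAbsSum Ψ := by exact_mod_cast hnewΨ
      push_cast
      gcongr
      exact h1.trans (le_mul_of_one_le_left (mul_nonneg ha hb) (by nlinarith))

lemma natAbs_coeff_le_polyHeight (f : ℤ[X]) (i : ℕ) : (f.coeff i).natAbs ≤ polyHeight f := by
  by_cases h : i ∈ f.support
  · exact Finset.le_sup (f := fun i => (f.coeff i).natAbs) h
  · simp [notMem_support_iff.mp h]

lemma polyHeight_expand_le {p : ℕ} (hp : 0 < p) (f : ℤ[X]) :
    polyHeight (expand ℤ p f) ≤ polyHeight f := by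
  refine Finset.sup_le fun i _ => ?_
  rw [coeff_expand hp]
  split_ifs
  · exact natAbs_coeff_le_polyHeight _ _
  · simp

lemma A_le_two_mul_exp_weightedLogSum {n : ℕ} (hn : n ≠ 0) :
    (A n : ℝ) ≤ 2 * Real.exp (3 * weightedLogSum n.primeFactors) := by
  induction n using Nat.strong_induction_on with
  | _ n ih =>
    by_cases hsq : Squarefree n
    · obtain ⟨Ψ, -, h, -⟩ := exists_cyclotomic_mul_eq_and_coeffAbsSum_le n.primeFactors
        fun p => Nat.prime_of_mem_primeFactors
      rw [Nat.prod_primeFactors_of_squarefree hsq] at h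
      have h1 : (A n : ℤ) ≤ coeffAbsSum (cyclotomic n ℤ) := by
        have : A n ≤ (coeffAbsSum (cyclotomic n ℤ)).toNat := Finset.sup_le fun i _ => by
          have := abs_coeff_le_coeffAbsSum (cyclotomic n ℤ) i
          rw [Int.abs_eq_natAbs] at this
          omega
        have := coeffAbsSum_nonneg (cyclotomic n ℤ)
        omega
      have h2 : (A n : ℝ) ≤ coeffAbsSum (cyclotomic n ℤ) := by exact_mod_cast h1
      refine h2.trans (le_trans ?_ h)
      have h0 : (0 : ℝ) ≤ coeffAbsSum (cyclotomic n ℤ) := by exact_mod_cast coeffAbsSum_nonneg _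
      exact le_mul_of_one_le_right h0 (by exact_mod_cast Nat.one_le_iff_ne_zero.mpr hn)
    · rw [Nat.squarefree_iff_prime_squarefree] at hsq
      push Not at hsq
      obtain ⟨p, hp, k, rfl⟩ := hsq
      have hk : k ≠ 0 := by rintro rfl; simp at hn
      have hpk : p * k ≠ 0 := mul_ne_zero hp.ne_zero hk
      have hlt : p * k < p * p * k := by
        rw [mul_assoc]
        exact lt_mul_of_one_lt_left (Nat.pos_of_ne_zero hpk) hp.one_lt
      have hfac : (p * p * k).primeFactors = (p * k).primeFactors := by
        rw [mul_assoc, Nat.primeFactors_mul hp.ne_zero hpk, Finset.union_eq_right]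
        exact Nat.primeFactors_mono (dvd_mul_right p k) hpk
      rw [hfac]
      refine le_trans ?_ (ih _ hlt hpk)
      have hexp := cyclotomic_expand_eq_cyclotomic hp (dvd_mul_right p k) ℤ
      rw [A, A, show p * p * k = p * k * p by ring, ← hexp]
      exact_mod_cast polyHeight_expand_le hp.pos _

lemma sum_primes_log_mul_le {f g : ℕ → ℝ} {M : ℕ} (hf : ∀ n, M ≤ n → 0 ≤ f n)
    (hanti : ∀ n, M ≤ n → f (n + 1) ≤ f n) (hfg : ∀ n, M ≤ n → f (n + 1) ≤ g (n + 1) - g n)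
    {N : ℕ} (hMN : M ≤ N) :
    ∑ q ∈ (Finset.Ioc M N).filter Nat.Prime, Real.log q * f q ≤
      Real.log 4 * (M * f M + (g N - g M)) := by
  have htheta (n : ℕ) : Chebyshev.theta n ≤ Real.log 4 * n :=
    Chebyshev.theta_le_log4_mul_x n.cast_nonneg
  have hsucc (n : ℕ) : Chebyshev.theta (n + 1 : ℕ) =
      Chebyshev.theta n + if (n + 1).Prime then Real.log (n + 1 : ℕ) else 0 := by
    rw [Chebyshev.theta_eq_sum_Icc, Chebyshev.theta_eq_sum_Icc, Nat.floor_natCast,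
      Nat.floor_natCast, Finset.sum_filter, Finset.sum_filter, Finset.sum_Icc_succ_top (by omega)]
  suffices h : ∑ q ∈ (Finset.Ioc M N).filter Nat.Prime, Real.log q * f q +
      (Real.log 4 * N - Chebyshev.theta N) * f N ≤ Real.log 4 * (M * f M + (g N - g M)) from
    le_trans (le_add_of_nonneg_right
      (mul_nonneg (sub_nonneg.mpr (htheta N)) (hf N hMN))) h
  induction N, hMN using Nat.le_induction with
  | base =>
    have := mul_nonneg (Chebyshev.theta_nonneg M) (hf M le_rfl)
    simp only [Finset.Ioc_self, Finset.filter_empty, Finset.sum_empty]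
    linarith
  | succ n hn ih =>
    have h1 := mul_le_mul_of_nonneg_left (hanti n hn) (sub_nonneg.mpr (htheta n))
    have h2 := mul_le_mul_of_nonneg_left (hfg n hn) (Real.log_nonneg (show (1 : ℝ) ≤ 4 by norm_num))
    rw [Finset.sum_filter, Finset.sum_Ioc_succ_top (by omega), ← Finset.sum_filter, hsucc]
    split_ifs <;> push_cast at * <;> linarith

lemma one_div_le_log_succ_sub_log {n : ℕ} (hn : 0 < n) :
    1 / ((n + 1 : ℕ) : ℝ) ≤ Real.log (n + 1 : ℕ) - Real.log n := by
  have hn' : (0 : ℝ) < n := by exact_mod_cast hn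
  rw [← Real.log_div (by positivity) hn'.ne']
  refine le_trans (le_of_eq ?_) (Real.one_sub_inv_le_log_of_pos (by positivity))
  push_cast
  field_simp
  ring

lemma sum_primes_one_div_le {M N : ℕ} (hM : 2 ≤ M) (hMN : M ≤ N) :
    ∑ q ∈ (Finset.Ioc M N).filter Nat.Prime, (1 : ℝ) / q ≤
      2 + Real.log 4 * (Real.log (Real.log N) - Real.log (Real.log M)) := by
  have hlog (n : ℕ) (hn : M ≤ n) : 0 < Real.log n :=
    Real.log_pos (by exact_mod_cast (show 1 < n by omega))
  have hcast (n : ℕ) (hn : M ≤ n) : (0 : ℝ) < n := by exact_mod_cast (show 0 < n by omega)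
  have hlog_mono (n : ℕ) (hn : M ≤ n) : Real.log n ≤ Real.log (n + 1 : ℕ) :=
    Real.log_le_log (hcast n hn) (by push_cast; linarith)
  have h := sum_primes_log_mul_le (f := fun n => 1 / (n * Real.log n))
    (g := fun n => Real.log (Real.log n)) (M := M)
    (fun n hn => by have := hlog n hn; positivity)
    (fun n hn => one_div_le_one_div_of_le (mul_pos (hcast n hn) (hlog n hn))
      (mul_le_mul (by push_cast; linarith) (hlog_mono n hn) (hlog n hn).le (by positivity)))
    (fun n hn => by
      have h0 := hlog n hn
      have h1 := hlog (n + 1) (by omega)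
      have h2 := one_div_le_log_succ_sub_log (n := n) (by omega)
      rw [← Real.log_div h1.ne' h0.ne']
      refine le_trans ?_ (Real.one_sub_inv_le_log_of_pos (div_pos h1 h0))
      rw [inv_div, ← div_div, one_sub_div h1.ne']
      gcongr) hMN
  refine le_trans (le_of_eq (Finset.sum_congr rfl fun q hq => ?_)) (h.trans ?_)
  · have h0 := hlog q (Finset.mem_Ioc.mp (Finset.mem_filter.mp hq).1).1.le
    have h1 := hcast q (Finset.mem_Ioc.mp (Finset.mem_filter.mp hq).1).1.le
    field_simp
  · have h0 := hcast M le_rfl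
    have h1 : Real.log 2 ≤ Real.log M := Real.log_le_log (by norm_num) (by exact_mod_cast hM)
    have h2 : Real.log 4 = 2 * Real.log 2 := by
      rw [show (4 : ℝ) = 2 ^ 2 by norm_num, Real.log_pow]; norm_num
    have h3 : Real.log 4 * (M * (1 / (M * Real.log M))) ≤ 2 := by
      rw [mul_one_div, div_mul_cancel_left₀ h0.ne', ← div_eq_mul_inv, div_le_iff₀ (hlog M le_rfl)]
      linarith
    rw [mul_add]
    linarith

lemma sum_primes_log_rpow_div_le {δ : ℝ} (hδ : 0 < δ) (hδ1 : δ ≤ 1) :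
    ∃ C : ℝ, 0 ≤ C ∧ ∀ N : ℕ, 2 ≤ N →
      ∑ p ∈ (Finset.Icc 1 N).filter Nat.Prime, Real.log p ^ δ / p ≤ C * Real.log N ^ δ := by
  have hlog (n : ℕ) (hn : 2 ≤ n) : 0 < Real.log n :=
    Real.log_pos (by exact_mod_cast (show 1 < n by omega))
  have hcast (n : ℕ) (hn : 2 ≤ n) : (0 : ℝ) < n := by exact_mod_cast (show 0 < n by omega)
  have hlog_mono (n : ℕ) (hn : 2 ≤ n) : Real.log n ≤ Real.log (n + 1 : ℕ) :=
    Real.log_le_log (hcast n hn) (by push_cast; linarith)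
  have hlog2 : 0 < Real.log 2 := Real.log_pos (by norm_num)
  have hlog4 : 0 ≤ Real.log 4 := Real.log_nonneg (by norm_num)
  set K : ℝ := Real.log 2 ^ δ / 2 + Real.log 4 * Real.log 2 ^ (δ - 1) with hK
  refine ⟨K / Real.log 2 ^ δ + Real.log 4 / δ, by positivity, fun N hN => ?_⟩
  have h := sum_primes_log_mul_le (f := fun n => Real.log n ^ (δ - 1) / n)
    (g := fun n => Real.log n ^ δ / δ) (M := 2)
    (fun n hn => by have := hlog n hn; positivity)
    (fun n hn => div_le_div₀ (by have := hlog n hn; positivity)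
      (Real.rpow_le_rpow_of_nonpos (hlog n hn) (hlog_mono n hn) (by linarith))
      (hcast n hn) (by push_cast; linarith))
    (fun n hn => by
      have ha := hlog (n + 1) (by omega)
      have hb := hlog n hn
      have hab := one_div_le_log_succ_sub_log (n := n) (by omega)
      set a := Real.log (n + 1 : ℕ)
      set b := Real.log n
      have hbern := rpow_one_add_le_one_add_mul_self (s := b / a - 1)
        (by have := div_pos hb ha; linarith) hδ.le hδ1
      rw [add_sub_cancel, Real.div_rpow hb.le ha.le, div_le_iff₀ (by positivity)] at hbern
      have hsplit : a ^ δ = a ^ (δ - 1) * a := by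
        rw [Real.rpow_sub_one ha.ne', div_mul_cancel₀ _ ha.ne']
      have hexpand : (1 + δ * (b / a - 1)) * a ^ δ = a ^ δ - δ * (a ^ (δ - 1) * (a - b)) := by
        rw [hsplit]
        field_simp
        ring
      rw [← sub_div, le_div_iff₀ hδ]
      have h1 := mul_le_mul_of_nonneg_left hab (show 0 ≤ δ * a ^ (δ - 1) by positivity)
      calc a ^ (δ - 1) / ((n + 1 : ℕ) : ℝ) * δ
          = δ * a ^ (δ - 1) * (1 / ((n + 1 : ℕ) : ℝ)) := by ring
        _ ≤ _ := h1
        _ ≤ _ := by linarith) hN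
  have hset : (Finset.Icc 1 N).filter Nat.Prime =
      insert 2 ((Finset.Ioc 2 N).filter Nat.Prime) := by
    ext q
    simp only [Finset.mem_filter, Finset.mem_Icc, Finset.mem_insert, Finset.mem_Ioc]
    constructor
    · rintro ⟨⟨-, h1⟩, h2⟩
      have := h2.two_le
      by_cases hq : q = 2
      · exact Or.inl hq
      · exact Or.inr ⟨⟨by omega, h1⟩, h2⟩
    · rintro (rfl | ⟨⟨h1, h2⟩, h3⟩)
      · exact ⟨⟨by omega, hN⟩, Nat.prime_two⟩
      · exact ⟨⟨by omega, h2⟩, h3⟩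
  rw [hset, Finset.sum_insert (by simp)]
  have hterm : ∑ q ∈ (Finset.Ioc 2 N).filter Nat.Prime, Real.log q ^ δ / q =
      ∑ q ∈ (Finset.Ioc 2 N).filter Nat.Prime, Real.log q * (Real.log q ^ (δ - 1) / q) := by
    refine Finset.sum_congr rfl fun q hq => ?_
    have h0 := hlog q (Finset.mem_Ioc.mp (Finset.mem_filter.mp hq).1).1.le
    rw [Real.rpow_sub_one h0.ne']
    field_simp
  rw [hterm]
  have hKle : K ≤ K / Real.log 2 ^ δ * Real.log N ^ δ := by
    rw [div_mul_eq_mul_div, le_div_iff₀ (by positivity)]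
    have : Real.log 2 ^ δ ≤ Real.log N ^ δ :=
      Real.rpow_le_rpow hlog2.le (Real.log_le_log (by norm_num) (by exact_mod_cast hN)) hδ.le
    exact mul_le_mul_of_nonneg_left this (by positivity)
  have hrest : 0 ≤ Real.log 4 * (Real.log 2 ^ δ / δ) := by positivity
  rw [add_mul]
  push_cast at h ⊢
  have e1 : Real.log 4 * (2 * (Real.log 2 ^ (δ - 1) / 2)) = Real.log 4 * Real.log 2 ^ (δ - 1) := by
    ring
  have e2 : Real.log 4 / δ * Real.log N ^ δ = Real.log 4 * (Real.log N ^ δ / δ) := by ring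
  rw [e2]
  rw [mul_add, mul_sub, e1] at h
  linarith

lemma sum_one_add_pow_card_dvd_le {β : ℝ} (hβ : 0 ≤ β) (x : ℕ) (P : Finset ℕ)
    (hP : ∀ q ∈ P, q.Prime) {d : ℕ} (hd : ∀ q ∈ P, d.Coprime q) :
    ∑ n ∈ (Finset.Icc 1 x).filter (d ∣ ·), (1 + β) ^ (P.filter (· ∣ n)).card ≤
      x / d * ∏ q ∈ P, (1 + β / q) := by
  induction P using Finset.induction_on generalizing d with
  | empty =>
    have h := Nat.Ioc_filter_dvd_card_eq_div x d
    rw [← Finset.Icc_succ_left_eq_Ioc, Nat.succ_eq_succ, Nat.succ_eq_add_one, zero_add] at h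
    simpa [h] using Nat.cast_div_le (m := x) (n := d) (α := ℝ)
  | insert q P hq ih =>
    have hPq := hP q (Finset.mem_insert_self _ _)
    have hdq := hd q (Finset.mem_insert_self _ _)
    have hP' : ∀ r ∈ P, r.Prime := fun r hr => hP r (Finset.mem_insert_of_mem hr)
    have hd' : ∀ r ∈ P, d.Coprime r := fun r hr => hd r (Finset.mem_insert_of_mem hr)
    have h1 := ih hP' hd'
    have h2 := ih hP' (d := d * q) fun r hr => Nat.Coprime.mul_left (hd' r hr)
      ((Nat.coprime_primes hPq (hP' r hr)).mpr fun h => hq (h ▸ hr))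
    have hfilter : (Finset.Icc 1 x).filter (d * q ∣ ·) =
        ((Finset.Icc 1 x).filter (d ∣ ·)).filter (q ∣ ·) := by
      rw [Finset.filter_filter]
      exact Finset.filter_congr fun n _ =>
        ⟨fun h => ⟨dvd_of_mul_right_dvd h, dvd_of_mul_left_dvd h⟩,
          fun h => hdq.mul_dvd_of_dvd_of_dvd h.1 h.2⟩
    rw [hfilter, Finset.sum_filter] at h2
    have hsum : ∀ n, (1 + β) ^ ((insert q P).filter (· ∣ n)).card =
        (1 + β) ^ (P.filter (· ∣ n)).card +
          β * if q ∣ n then (1 + β) ^ (P.filter (· ∣ n)).card else 0 := by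
      intro n
      rw [Finset.filter_insert]
      split_ifs
      · rw [Finset.card_insert_of_notMem (by simp [hq]), pow_succ]
        ring
      · ring
    simp_rw [hsum]
    rw [Finset.sum_add_distrib, ← Finset.mul_sum, Finset.prod_insert hq]
    refine (add_le_add h1 (mul_le_mul_of_nonneg_left h2 hβ)).trans (le_of_eq ?_)
    push_cast
    rw [← div_div]
    ring

lemma rpow_sum_le_sum_rpow {ι : Type*} (s : Finset ι) {f : ι → ℝ} (hf : ∀ i ∈ s, 0 ≤ f i) {α : ℝ}
    (hα : 0 < α) (hα1 : α ≤ 1) : (∑ i ∈ s, f i) ^ α ≤ ∑ i ∈ s, f i ^ α := by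
  induction s using Finset.induction_on with
  | empty => simp [Real.zero_rpow hα.ne']
  | insert a s ha ih =>
    rw [Finset.sum_insert ha, Finset.sum_insert ha]
    have hs : ∀ i ∈ s, 0 ≤ f i := fun i hi => hf i (Finset.mem_insert_of_mem hi)
    exact (Real.rpow_add_le_add_rpow (hf a (Finset.mem_insert_self _ _))
      (Finset.sum_nonneg hs) hα.le hα1).trans (by linarith [ih hs])

lemma weightedLogSum_rpow_le {α β : ℝ} (hα : 0 < α) (hα1 : α ≤ 1) (hαβ : (2 : ℝ) ^ α ≤ 1 + β)
    (S : Finset ℕ) :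
    weightedLogSum S ^ α ≤
      ∑ p ∈ S, Real.log p ^ α * (1 + β) ^ (S.filter (p < ·)).card := by
  refine (rpow_sum_le_sum_rpow S (fun p _ => mul_nonneg (by positivity)
    (Real.log_natCast_nonneg p)) hα hα1).trans (Finset.sum_le_sum fun p _ => ?_)
  rw [Real.mul_rpow (by positivity) (Real.log_natCast_nonneg p), mul_comm, ← Real.rpow_natCast,
    ← Real.rpow_mul (by norm_num), mul_comm (_ : ℝ) α, Real.rpow_mul (by norm_num),
    Real.rpow_natCast]
  have := Real.log_natCast_nonneg p
  gcongr

lemma prod_primes_one_add_div_le {β : ℝ} (hβ : 0 ≤ β) {p x : ℕ} (hp : 2 ≤ p) (hpx : p ≤ x) :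
    ∏ q ∈ (Finset.Ioc p x).filter Nat.Prime, (1 + β / q) ≤
      Real.exp (2 * β) * (Real.log x / Real.log p) ^ (β * Real.log 4) := by
  have hp0 : 0 < Real.log p := Real.log_pos (by exact_mod_cast hp)
  have hx0 : 0 < Real.log x := Real.log_pos (by exact_mod_cast hp.trans hpx)
  calc ∏ q ∈ (Finset.Ioc p x).filter Nat.Prime, (1 + β / q)
      ≤ ∏ q ∈ (Finset.Ioc p x).filter Nat.Prime, Real.exp (β * (1 / q)) :=
        Finset.prod_le_prod (fun q _ => by positivity) fun q _ => by
          rw [mul_one_div, add_comm]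
          exact Real.add_one_le_exp _
    _ = Real.exp (β * ∑ q ∈ (Finset.Ioc p x).filter Nat.Prime, (1 : ℝ) / q) := by
        rw [Finset.mul_sum, Real.exp_sum]
    _ ≤ Real.exp (β * (2 + Real.log 4 * (Real.log (Real.log x) - Real.log (Real.log p)))) :=
        Real.exp_le_exp.mpr (mul_le_mul_of_nonneg_left (sum_primes_one_div_le hp hpx) hβ)
    _ = _ := by
        rw [Real.rpow_def_of_pos (div_pos hx0 hp0), Real.log_div hx0.ne' hp0.ne', ← Real.exp_add]
        congr 1
        ring

lemma sum_weightedLogSum_rpow_le {α β : ℝ} (hα : 0 < α) (hα1 : α ≤ 1) (hβ : 0 ≤ β)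
    (hαβ : (2 : ℝ) ^ α ≤ 1 + β) (hβα : β * Real.log 4 < α) :
    ∃ C : ℝ, 0 ≤ C ∧ ∀ x : ℕ, 2 ≤ x →
      ∑ n ∈ Finset.Icc 1 x, weightedLogSum n.primeFactors ^ α ≤ C * x * Real.log x ^ α := by
  have hlog4 : 0 ≤ Real.log 4 := Real.log_nonneg (by norm_num)
  obtain ⟨C, hC, hsum⟩ := sum_primes_log_rpow_div_le (δ := α - β * Real.log 4) (by linarith)
    (by linarith [mul_nonneg hβ hlog4])
  refine ⟨Real.exp (2 * β) * C, by positivity, fun x hx => ?_⟩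
  have hx0 : 0 < Real.log x := Real.log_pos (by exact_mod_cast hx)
  have hfilter : ∀ n ∈ Finset.Icc 1 x, ∀ p : ℕ, n.primeFactors.filter (p < ·) =
      ((Finset.Ioc p x).filter Nat.Prime).filter (· ∣ n) := by
    intro n hn p
    rw [Finset.mem_Icc] at hn
    ext q
    simp only [Finset.mem_filter, Nat.mem_primeFactors, Finset.mem_Ioc]
    constructor
    · rintro ⟨⟨h1, h2, -⟩, h4⟩
      exact ⟨⟨⟨h4, (Nat.le_of_dvd hn.1 h2).trans hn.2⟩, h1⟩, h2⟩
    · rintro ⟨⟨⟨h1, -⟩, h3⟩, h4⟩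
      exact ⟨⟨h3, h4, by omega⟩, h1⟩
  calc ∑ n ∈ Finset.Icc 1 x, weightedLogSum n.primeFactors ^ α
      ≤ ∑ n ∈ Finset.Icc 1 x, ∑ p ∈ n.primeFactors, Real.log p ^ α *
          (1 + β) ^ (((Finset.Ioc p x).filter Nat.Prime).filter (· ∣ n)).card :=
        Finset.sum_le_sum fun n hn => by
          simpa only [hfilter n hn] using weightedLogSum_rpow_le hα hα1 hαβ n.primeFactors
    _ = ∑ p ∈ (Finset.Icc 1 x).filter Nat.Prime, ∑ n ∈ (Finset.Icc 1 x).filter (p ∣ ·),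
          Real.log p ^ α * (1 + β) ^ (((Finset.Ioc p x).filter Nat.Prime).filter (· ∣ n)).card := by
        refine Finset.sum_comm' fun n p => ?_
        simp only [Finset.mem_filter, Nat.mem_primeFactors, Finset.mem_Icc]
        constructor
        · rintro ⟨⟨h1, h2⟩, h3, h4, -⟩
          exact ⟨⟨⟨h1, h2⟩, h4⟩, ⟨h3.one_le, (Nat.le_of_dvd h1 h4).trans h2⟩, h3⟩
        · rintro ⟨⟨⟨h1, h2⟩, h4⟩, -, h3⟩
          exact ⟨⟨h1, h2⟩, h3, h4, by omega⟩
    _ ≤ ∑ p ∈ (Finset.Icc 1 x).filter Nat.Prime,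
          Real.exp (2 * β) * x * Real.log x ^ (β * Real.log 4) *
            (Real.log p ^ (α - β * Real.log 4) / p) := by
        refine Finset.sum_le_sum fun p hp => ?_
        obtain ⟨hp1, hp⟩ := Finset.mem_filter.mp hp
        have hp0 : 0 < Real.log p := Real.log_pos (by exact_mod_cast hp.one_lt)
        rw [← Finset.mul_sum]
        calc _ ≤ Real.log p ^ α * (x / p * (Real.exp (2 * β) *
                (Real.log x / Real.log p) ^ (β * Real.log 4))) := by
              gcongr
              refine (sum_one_add_pow_card_dvd_le hβ x _
                (fun q hq => (Finset.mem_filter.mp hq).2) fun q hq => ?_).trans ?_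
              · obtain ⟨hq1, hq2⟩ := Finset.mem_filter.mp hq
                exact (Nat.coprime_primes hp hq2).mpr (Finset.mem_Ioc.mp hq1).1.ne
              · exact mul_le_mul_of_nonneg_left
                  (prod_primes_one_add_div_le hβ hp.two_le (Finset.mem_Icc.mp hp1).2)
                  (by positivity)
          _ = _ := by
              rw [Real.div_rpow hx0.le hp0.le, Real.rpow_sub hp0]
              ring
    _ ≤ Real.exp (2 * β) * x * Real.log x ^ (β * Real.log 4) *
          (C * Real.log x ^ (α - β * Real.log 4)) := by
        rw [← Finset.mul_sum]
        exact mul_le_mul_of_nonneg_left (hsum x hx) (by positivity)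
    _ = _ := by
        rw [Real.rpow_sub hx0]
        field_simp

lemma exists_card_weightedLogSum_gt_le :
    ∃ α C : ℝ, 0 < α ∧ 0 ≤ C ∧ ∀ T : ℝ, 0 < T → ∀ x : ℕ, 2 ≤ x →
      (((Finset.Icc 1 x).filter
        (fun n => T * Real.log x < weightedLogSum n.primeFactors)).card : ℝ) ≤
        C / T ^ α * x := by
  have hβ : (2 : ℝ) ^ (1 / 16 : ℝ) ≤ 1 + 9 / 200 := by
    rw [one_div, Real.rpow_inv_le_iff_of_pos (by norm_num) (by norm_num) (by norm_num)]
    norm_num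
  have hlog4 : 9 / 200 * Real.log 4 < 1 / 16 := by
    rw [show (4 : ℝ) = 2 ^ 2 by norm_num, Real.log_pow]
    have := Real.log_two_lt_d9
    norm_num at this ⊢
    linarith
  obtain ⟨C, hC, hsum⟩ :=
    sum_weightedLogSum_rpow_le (by norm_num) (by norm_num) (by norm_num) hβ hlog4
  refine ⟨1 / 16, C, by norm_num, hC, fun T hT x hx => ?_⟩
  have hx0 : 0 < Real.log x := Real.log_pos (by exact_mod_cast hx)
  have hTα : 0 < T ^ (1 / 16 : ℝ) := by positivity
  have hxα : 0 < Real.log x ^ (1 / 16 : ℝ) := by positivity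
  have h1 := Finset.card_nsmul_le_sum ((Finset.Icc 1 x).filter
    (fun n => T * Real.log x < weightedLogSum n.primeFactors))
    (fun n => weightedLogSum n.primeFactors ^ (1 / 16 : ℝ)) ((T * Real.log x) ^ (1 / 16 : ℝ))
    fun n hn => Real.rpow_le_rpow (by positivity) (Finset.mem_filter.mp hn).2.le (by norm_num)
  have h2 := Finset.sum_le_sum_of_subset_of_nonneg (Finset.filter_subset
    (fun n => T * Real.log x < weightedLogSum n.primeFactors) (Finset.Icc 1 x))
    (f := fun n => weightedLogSum n.primeFactors ^ (1 / 16 : ℝ))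
    fun n _ _ => Real.rpow_nonneg (weightedLogSum_nonneg _) _
  have h3 := (h1.trans h2).trans (hsum x hx)
  rw [nsmul_eq_mul, Real.mul_rpow hT.le hx0.le, ← mul_assoc] at h3
  rw [div_mul_eq_mul_div, le_div_iff₀ hTα]
  exact le_of_mul_le_mul_right h3 hxα

/-- Maier: If ψ(n) → ∞ then A(n) ≤ n^{ψ(n)} for almost all n. -/
theorem cyclotomic_height_bound (ψ : ℕ → ℝ)
    (hψ : Tendsto ψ atTop atTop) :
    Tendsto (fun x : ℕ =>
        (((Finset.Icc 1 x).filter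
          (fun n => (A n : ℝ) > (n : ℝ) ^ (ψ n))).card : ℝ) / (x : ℝ))
      atTop (nhds 0) := by
  obtain ⟨α, C, hα, hC, hcard⟩ := exists_card_weightedLogSum_gt_le
  rw [Metric.tendsto_atTop']
  intro ε hε
  have hT : Tendsto (fun T : ℝ => C / T ^ α) atTop (nhds 0) :=
    (tendsto_rpow_atTop hα).const_div_atTop C
  obtain ⟨T, hTε, hT0⟩ :=
    ((hT.eventually (gt_mem_nhds (half_pos hε))).and (eventually_gt_atTop 0)).exists
  obtain ⟨N, hN⟩ := eventually_atTop.mp (hψ.eventually_ge_atTop (6 * T + 2))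
  have hsmall : Tendsto (fun x : ℕ => ((N : ℝ) + 1) / x + 1 / Real.sqrt x) atTop (nhds 0) := by
    have h1 : Tendsto (fun x : ℕ => ((N : ℝ) + 1) / x) atTop (nhds 0) :=
      tendsto_natCast_atTop_atTop.const_div_atTop _
    have h2 : Tendsto (fun x : ℕ => 1 / Real.sqrt x) atTop (nhds 0) :=
      (Real.tendsto_sqrt_atTop.comp tendsto_natCast_atTop_atTop).const_div_atTop _
    simpa using h1.add h2
  obtain ⟨X, hX⟩ := eventually_atTop.mp
    ((hsmall.eventually (gt_mem_nhds (half_pos hε))).and (eventually_ge_atTop 2))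
  refine ⟨X, fun x hx => ?_⟩
  obtain ⟨hxε, hx2⟩ := hX x hx.le
  have hxpos : (0 : ℝ) < x := by exact_mod_cast (show 0 < x by omega)
  have hsub : (Finset.Icc 1 x).filter (fun n => (A n : ℝ) > (n : ℝ) ^ (ψ n)) ⊆
      Finset.range (N + 1) ∪ Finset.Icc 1 (Nat.sqrt x) ∪ (Finset.Icc 1 x).filter
        (fun n => T * Real.log x < weightedLogSum n.primeFactors) := by
    intro n hn
    obtain ⟨hn, hA⟩ := Finset.mem_filter.mp hn
    rw [Finset.mem_union, Finset.mem_union, Finset.mem_range, Finset.mem_Icc, Finset.mem_filter]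
    by_cases hnN : n < N + 1
    · exact Or.inl (Or.inl hnN)
    by_cases hnx : n ≤ Nat.sqrt x
    · exact Or.inl (Or.inr ⟨(Finset.mem_Icc.mp hn).1, hnx⟩)
    refine Or.inr ⟨hn, ?_⟩
    have hn0 : (0 : ℝ) < n := by exact_mod_cast (Finset.mem_Icc.mp hn).1
    have hxn : (x : ℝ) ≤ n ^ 2 := by
      have := Nat.sqrt_lt.mp (not_le.mp hnx)
      rw [pow_two]
      exact_mod_cast this.le
    have hlogx : Real.log x ≤ 2 * Real.log n := by
      have := Real.log_le_log hxpos hxn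
      rwa [Real.log_pow] at this
    have hlog2 : Real.log 2 ≤ Real.log x :=
      Real.log_le_log (by norm_num) (by exact_mod_cast hx2)
    have h1 := hA.trans_le
      (A_le_two_mul_exp_weightedLogSum (by exact_mod_cast hn0.ne'))
    have h2 := Real.log_lt_log (by positivity) h1
    rw [Real.log_rpow hn0, Real.log_mul (by norm_num) (Real.exp_ne_zero _), Real.log_exp] at h2
    have hψn := hN n (by omega)
    have hlogn : 0 ≤ Real.log n := Real.log_natCast_nonneg n
    have h3 := mul_le_mul_of_nonneg_right hψn hlogn
    have h4 := mul_le_mul_of_nonneg_left hlogx hT0.le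
    linarith
  have hcard_le : (((Finset.Icc 1 x).filter
      (fun n => (A n : ℝ) > (n : ℝ) ^ (ψ n))).card : ℝ) ≤
      ((N : ℝ) + 1) + Real.sqrt x + C / T ^ α * x := by
    have h1 := (Finset.card_le_card hsub).trans ((Finset.card_union_le _ _).trans
      (Nat.add_le_add_right (Finset.card_union_le _ _) _))
    rw [Finset.card_range, Nat.card_Icc, Nat.add_sub_cancel] at h1
    have h2 : (Nat.sqrt x : ℝ) ≤ Real.sqrt x := Real.nat_sqrt_le_real_sqrt
    have h3 := hcard T hT0 x hx2
    have h4 := (Nat.cast_le (α := ℝ)).mpr h1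
    push_cast at h4
    linarith
  rw [Real.dist_eq, sub_zero, abs_of_nonneg (by positivity), div_lt_iff₀ hxpos]
  have hsqrt : 1 / Real.sqrt x * x = Real.sqrt x := by
    rw [one_div, inv_mul_eq_div, Real.div_sqrt]
  have h1 := mul_lt_mul_of_pos_right hxε hxpos
  have h2 := mul_lt_mul_of_pos_right hTε hxpos
  rw [add_mul, hsqrt, div_mul_cancel₀ _ hxpos.ne'] at h1
  linarith
end

section
/- Let γ be a real number with 2 < γ < e. Then the set {n : ω(n) ≥ (log log n)/(log γ)} has asymptotic density 0; that is, #{n ≤ x : ω(n) ≥ (log log n)/(log γ)}/x → 0 as x → ∞. -/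
open Polynomial Filter
open scoped Classical

/-- The sum of the reciprocals of the primes up to `x`. -/
noncomputable def primeReciprocalSum (x : ℕ) : ℝ := ∑ p ∈ Nat.primesLE x, 1 / (p : ℝ)

lemma primeReciprocalSum_nonneg (x : ℕ) : 0 ≤ primeReciprocalSum x :=
  Finset.sum_nonneg fun _ _ => by positivity

lemma omegaCount_eq_sum {x n : ℕ} (hn : n ∈ Finset.Ioc 0 x) :
    (omegaCount n : ℝ) = ∑ p ∈ Nat.primesLE x, if p ∣ n then (1 : ℝ) else 0 := by
  rw [Finset.sum_boole, omegaCount]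
  congr 2
  ext p
  simp only [Finset.mem_Ioc] at hn
  simp only [Nat.mem_primeFactors, Finset.mem_filter, Nat.mem_primesLE]
  constructor
  · rintro ⟨hp, hd, -⟩
    exact ⟨⟨(Nat.le_of_dvd hn.1 hd).trans hn.2, hp⟩, hd⟩
  · rintro ⟨⟨-, hp⟩, hd⟩
    exact ⟨hp, hd, hn.1.ne'⟩

lemma sum_ite_dvd (x d : ℕ) :
    ∑ n ∈ Finset.Ioc 0 x, (if d ∣ n then (1 : ℝ) else 0) = (x / d : ℕ) := by
  rw [Finset.sum_boole, ← Nat.Ioc_filter_dvd_card_eq_div]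

lemma sum_omegaCount_ge (x : ℕ) :
    (x : ℝ) * primeReciprocalSum x - x ≤ ∑ n ∈ Finset.Ioc 0 x, (omegaCount n : ℝ) := by
  rw [Finset.sum_congr rfl fun n hn => omegaCount_eq_sum hn, Finset.sum_comm]
  simp only [sum_ite_dvd]
  have hcard : ((Nat.primesLE x).card : ℝ) ≤ x := by
    rw [Nat.primesLE_eq_filter_Icc_one]
    exact_mod_cast (Finset.card_filter_le _ _).trans (by simp)
  have hle : ∑ p ∈ Nat.primesLE x, ((x : ℝ) * (1 / p) - 1) ≤
      ∑ p ∈ Nat.primesLE x, ((x / p : ℕ) : ℝ) := by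
    refine Finset.sum_le_sum fun p _ => ?_
    have := Nat.sub_one_lt_floor ((x : ℝ) / p)
    rw [Nat.floor_div_eq_div] at this
    rw [mul_one_div]
    exact this.le
  rw [Finset.sum_sub_distrib, ← Finset.mul_sum, Finset.sum_const, nsmul_one] at hle
  unfold primeReciprocalSum
  linarith

lemma sum_omegaCount_sq_le (x : ℕ) :
    ∑ n ∈ Finset.Ioc 0 x, (omegaCount n : ℝ) ^ 2 ≤
      x * primeReciprocalSum x ^ 2 + x * primeReciprocalSum x := by
  have hexp : ∀ n ∈ Finset.Ioc 0 x, (omegaCount n : ℝ) ^ 2 =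
      ∑ p ∈ Nat.primesLE x, ∑ q ∈ Nat.primesLE x, if p ∣ n ∧ q ∣ n then (1 : ℝ) else 0 := by
    intro n hn
    rw [omegaCount_eq_sum hn, sq, Finset.sum_mul_sum]
    refine Finset.sum_congr rfl fun p _ => Finset.sum_congr rfl fun q _ => ?_
    by_cases hp : p ∣ n <;> by_cases hq : q ∣ n <;> simp [hp, hq]
  have hpair : ∀ p ∈ Nat.primesLE x, ∀ q ∈ Nat.primesLE x,
      ∑ n ∈ Finset.Ioc 0 x, (if p ∣ n ∧ q ∣ n then (1 : ℝ) else 0) ≤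
        x * (1 / p * (1 / q)) + if p = q then (x : ℝ) * (1 / p) else 0 := by
    intro p hp q hq
    have hp' := Nat.prime_of_mem_primesLE hp
    have hq' := Nat.prime_of_mem_primesLE hq
    by_cases hpq : p = q
    · subst hpq
      simp only [and_self, sum_ite_dvd, if_true]
      have h := Nat.cast_div_le (α := ℝ) (m := x) (n := p)
      rw [mul_one_div (x : ℝ) (p : ℝ)]
      have : (0 : ℝ) ≤ x * (1 / p * (1 / p)) := by positivity
      linarith
    · have hcop : Nat.Coprime p q := (Nat.coprime_primes hp' hq').2 hpq
      have hiff : ∀ n, (p ∣ n ∧ q ∣ n) ↔ p * q ∣ n := fun n =>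
        ⟨fun h => hcop.mul_dvd_of_dvd_of_dvd h.1 h.2,
          fun h => ⟨(dvd_mul_right p q).trans h, (dvd_mul_left q p).trans h⟩⟩
      simp only [hiff, sum_ite_dvd, if_neg hpq, add_zero]
      refine (Nat.cast_div_le (α := ℝ)).trans (le_of_eq ?_)
      push_cast
      rw [one_div_mul_one_div, mul_one_div]
  calc ∑ n ∈ Finset.Ioc 0 x, (omegaCount n : ℝ) ^ 2
      = ∑ p ∈ Nat.primesLE x, ∑ q ∈ Nat.primesLE x, ∑ n ∈ Finset.Ioc 0 x,
          if p ∣ n ∧ q ∣ n then (1 : ℝ) else 0 := by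
        rw [Finset.sum_congr rfl hexp, Finset.sum_comm]
        exact Finset.sum_congr rfl fun p _ => Finset.sum_comm
    _ ≤ ∑ p ∈ Nat.primesLE x, ∑ q ∈ Nat.primesLE x,
          (x * (1 / p * (1 / q)) + if p = q then (x : ℝ) * (1 / p) else 0) :=
        Finset.sum_le_sum fun p hp => Finset.sum_le_sum fun q hq => hpair p hp q hq
    _ = x * primeReciprocalSum x ^ 2 + x * primeReciprocalSum x := by
        simp only [Finset.sum_add_distrib, ← Finset.mul_sum, Finset.sum_ite_eq, primeReciprocalSum,
          sq, Finset.sum_mul_sum]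
        congr 1
        rw [Finset.mul_sum]
        exact Finset.sum_congr rfl fun p hp => if_pos hp

/-- Turán's variance bound. -/
lemma sum_omegaCount_sub_sq_le (x : ℕ) :
    ∑ n ∈ Finset.Ioc 0 x, ((omegaCount n : ℝ) - primeReciprocalSum x) ^ 2 ≤
      3 * (x * primeReciprocalSum x) := by
  have h1 := sum_omegaCount_sq_le x
  have h2 := mul_le_mul_of_nonneg_left (sum_omegaCount_ge x) (primeReciprocalSum_nonneg x)
  simp only [sub_sq, Finset.sum_add_distrib, Finset.sum_sub_distrib, ← Finset.sum_mul,
    ← Finset.mul_sum, Finset.sum_const, Nat.card_Ioc, nsmul_eq_mul, tsub_zero]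
  nlinarith

/-- Chebyshev's inequality for `ω`. -/
lemma card_omegaCount_ge_le (x : ℕ) {t : ℝ} (ht : 0 < t) :
    (((Finset.Ioc 0 x).filter fun n => primeReciprocalSum x + t ≤ omegaCount n).card : ℝ) ≤
      3 * (x * primeReciprocalSum x) / t ^ 2 := by
  rw [le_div_iff₀ (by positivity)]
  refine le_trans ?_ (sum_omegaCount_sub_sq_le x)
  rw [← nsmul_eq_mul, ← Finset.sum_const]
  refine (Finset.sum_le_sum fun n hn => ?_).trans
    (Finset.sum_le_sum_of_subset_of_nonneg (Finset.filter_subset _ _) fun _ _ _ => sq_nonneg _)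
  have := (Finset.mem_filter.1 hn).2
  exact pow_le_pow_left₀ ht.le (by linarith) 2

lemma sum_primesLE_rpow_le_log {s : ℝ} (hs : 1 < s) (x : ℕ) :
    ∑ p ∈ Nat.primesLE x, (p : ℝ) ^ (-s) ≤ Real.log (∑' n : ℕ, 1 / (n : ℝ) ^ s) := by
  let f : ℕ →* ℝ :=
    { toFun := fun n => (n : ℝ) ^ (-s)
      map_one' := by simp
      map_mul' := fun m n => by
        push_cast
        exact Real.mul_rpow (Nat.cast_nonneg _) (Nat.cast_nonneg _) }
  have hf : ∀ n : ℕ, f n = (n : ℝ) ^ (-s) := fun _ => rfl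
  have hf0 : ∀ n : ℕ, 0 ≤ f n := fun n => Real.rpow_nonneg (Nat.cast_nonneg _) _
  have hsum : Summable f := Real.summable_nat_rpow.2 (by linarith)
  have hlt : ∀ p ∈ Nat.primesLE x, f p < 1 := fun p hp =>
    Real.rpow_lt_one_of_one_lt_of_neg (by exact_mod_cast Nat.one_lt_of_mem_primesLE hp)
      (by linarith)
  have htsum : ∑' n : ℕ, 1 / (n : ℝ) ^ s = ∑' n, f n :=
    tsum_congr fun n => by rw [hf, Real.rpow_neg (Nat.cast_nonneg _), one_div]
  have hprod : ∏ p ∈ Nat.primesLE x, (1 - f p)⁻¹ ≤ ∑' n, f n :=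
    (EulerProduct.prod_primesBelow_geometric_eq_tsum_smoothNumbers hsum (x + 1)).trans_le
      (hsum.tsum_subtype_le f _ hf0)
  rw [htsum]
  have hpos : ∀ p ∈ Nat.primesLE x, 0 < (1 - f p)⁻¹ := fun p hp =>
    inv_pos.2 (sub_pos.2 (hlt p hp))
  refine le_trans ?_ (Real.log_le_log (Finset.prod_pos hpos) hprod)
  rw [Real.log_prod fun p hp => (hpos p hp).ne']
  refine Finset.sum_le_sum fun p hp => ?_
  rw [Real.log_inv, ← hf]
  have := Real.log_le_sub_one_of_pos (sub_pos.2 (hlt p hp))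
  linarith

/-- A weak form of the upper bound in Mertens' second theorem. -/
lemma exists_primeReciprocalSum_le {a : ℝ} (ha : 1 < a) :
    ∃ K : ℝ, ∀ᶠ x : ℕ in atTop,
      primeReciprocalSum x ≤ a * Real.log (Real.log x) + K := by
  set δ := Real.log a with hδ
  have hδ0 : 0 < δ := Real.log_pos ha
  have hlog : Tendsto (fun x : ℕ => Real.log x) atTop atTop :=
    Real.tendsto_log_atTop.comp tendsto_natCast_atTop_atTop
  have hs : Tendsto (fun x : ℕ => 1 + δ / Real.log x) atTop (nhdsWithin 1 (Set.Ioi 1)) := by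
    refine tendsto_nhdsWithin_iff.2 ⟨?_, ?_⟩
    · simpa using (hlog.const_div_atTop δ).const_add 1
    · filter_upwards [hlog.eventually_gt_atTop 0] with x hx
      simpa using div_pos hδ0 hx
  refine ⟨a * Real.log (2 / δ), ?_⟩
  filter_upwards [hlog.eventually_gt_atTop 0,
    (tendsto_sub_mul_tsum_nat_rpow.comp hs).eventually_lt_const one_lt_two,
    (tendsto_sub_mul_tsum_nat_rpow.comp hs).eventually_const_lt zero_lt_one] with x hx h2 h0
  simp only [Function.comp_apply, add_sub_cancel_left] at h2 h0
  set s := 1 + δ / Real.log x with hsdef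
  set Z := ∑' n : ℕ, 1 / (n : ℝ) ^ s
  have hq : 0 < δ / Real.log x := div_pos hδ0 hx
  have hZ : 0 < Z := pos_of_mul_pos_right h0 hq.le
  have hZle : Z ≤ Real.log x * (2 / δ) := by
    rw [← mul_div_assoc, le_div_iff₀ hδ0]
    rw [div_mul_eq_mul_div, div_lt_iff₀ hx] at h2
    linarith
  have hterm : ∀ p ∈ Nat.primesLE x, 1 / (p : ℝ) ≤ a * (p : ℝ) ^ (-s) := by
    intro p hp
    have hp0 : (0 : ℝ) < p := by exact_mod_cast (Nat.prime_of_mem_primesLE hp).pos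
    have hpx : (p : ℝ) ≤ x := by exact_mod_cast Nat.le_of_mem_primesLE hp
    have hle : (p : ℝ) ^ (δ / Real.log x) ≤ a := by
      rw [Real.rpow_def_of_pos hp0, ← Real.le_log_iff_exp_le (by linarith), ← hδ]
      calc Real.log p * (δ / Real.log x) ≤ Real.log x * (δ / Real.log x) := by gcongr
        _ = δ := by field_simp
    rw [hsdef, Real.rpow_neg hp0.le, Real.rpow_add hp0, Real.rpow_one]
    have hpq : 0 < (p : ℝ) ^ (δ / Real.log x) := Real.rpow_pos_of_pos hp0 _
    rw [← div_eq_mul_inv, div_le_div_iff₀ hp0 (by positivity)]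
    nlinarith
  calc primeReciprocalSum x ≤ ∑ p ∈ Nat.primesLE x, a * (p : ℝ) ^ (-s) :=
        Finset.sum_le_sum hterm
    _ = a * ∑ p ∈ Nat.primesLE x, (p : ℝ) ^ (-s) := by rw [Finset.mul_sum]
    _ ≤ a * Real.log Z := by
        gcongr
        exact sum_primesLE_rpow_le_log (by linarith) x
    _ ≤ a * Real.log (Real.log x * (2 / δ)) := by gcongr
    _ = a * Real.log (Real.log x) + a * Real.log (2 / δ) := by
        rw [Real.log_mul hx.ne' (by positivity), mul_add]

/-- The normal order upper bound: `ω n < c * log (log n)` for almost all `n`, for any `c > 1`. -/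
lemma tendsto_card_omegaCount_ge_div {c : ℝ} (hc : 1 < c) :
    Tendsto (fun x : ℕ =>
        (((Finset.Icc 1 x).filter
          (fun n => (omegaCount n : ℝ) ≥ c * Real.log (Real.log n))).card : ℝ) / (x : ℝ))
      atTop (nhds 0) := by
  obtain ⟨a, ha1, hac⟩ := exists_between hc
  obtain ⟨K, hK⟩ := exists_primeReciprocalSum_le ha1
  have hsqrt : Tendsto (fun x : ℕ => √(x : ℝ)) atTop atTop :=
    Real.tendsto_sqrt_atTop.comp tendsto_natCast_atTop_atTop
  have hlog : Tendsto (fun x : ℕ => Real.log x) atTop atTop :=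
    Real.tendsto_log_atTop.comp tendsto_natCast_atTop_atTop
  have hll : Tendsto (fun x : ℕ => Real.log (Real.log x)) atTop atTop :=
    Real.tendsto_log_atTop.comp hlog
  set b := (c - a) / 2 with hb
  have hb0 : 0 < b := by rw [hb]; linarith
  have hlim : Tendsto (fun x : ℕ => (√(x : ℝ))⁻¹ + 3 * c / b ^ 2 / Real.log (Real.log x))
      atTop (nhds 0) := by
    simpa using (tendsto_inv_atTop_zero.comp hsqrt).add (hll.const_div_atTop (3 * c / b ^ 2))
  refine squeeze_zero' (Eventually.of_forall fun x => by positivity) ?_ hlim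
  filter_upwards [hK, hlog.eventually_gt_atTop 0, hll.eventually_gt_atTop 0,
    hll.eventually_ge_atTop ((K + c * Real.log 2) / b), hll.eventually_ge_atTop (K / (c - a)),
    eventually_gt_atTop 0] with x hS hlx hllx hbig hbig' hx0
  rw [div_le_iff₀ hb0] at hbig
  rw [div_le_iff₀ (by linarith)] at hbig'
  set ℓ := Real.log (Real.log x) with hℓ
  set S := primeReciprocalSum x
  have hxpos : (0 : ℝ) < x := by exact_mod_cast hx0
  have hSc : S ≤ c * ℓ := by linarith
  have hthr : S + b * ℓ ≤ c * (ℓ - Real.log 2) := by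
    have : c * ℓ = a * ℓ + 2 * (b * ℓ) := by rw [hb]; ring
    linarith
  have hsub : (Finset.Icc 1 x).filter (fun n => (omegaCount n : ℝ) ≥ c * Real.log (Real.log n)) ⊆
      Finset.Ioc 0 ⌊√(x : ℝ)⌋₊ ∪
        (Finset.Ioc 0 x).filter fun n => S + b * ℓ ≤ omegaCount n := by
    intro n hn
    simp only [Finset.mem_filter, Finset.mem_Icc] at hn
    obtain ⟨⟨hn1, hnx⟩, hn⟩ := hn
    simp only [Finset.mem_union, Finset.mem_filter, Finset.mem_Ioc]
    by_cases hsmall : (n : ℝ) ≤ √(x : ℝ)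
    · exact Or.inl ⟨hn1, Nat.le_floor hsmall⟩
    · refine Or.inr ⟨⟨hn1, hnx⟩, hthr.trans (le_trans ?_ hn)⟩
      have h1 : Real.log x / 2 ≤ Real.log n := by
        rw [← Real.log_sqrt hxpos.le]
        exact Real.log_le_log (Real.sqrt_pos.2 hxpos) (not_le.1 hsmall).le
      have h2 : ℓ - Real.log 2 ≤ Real.log (Real.log n) := by
        rw [hℓ, ← Real.log_div hlx.ne' two_ne_zero]
        exact Real.log_le_log (by positivity) h1
      gcongr
  have hcard := (Finset.card_le_card hsub).trans (Finset.card_union_le _ _)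
  have hcheb := card_omegaCount_ge_le x (mul_pos hb0 hllx)
  have hfloor : (⌊√(x : ℝ)⌋₊ : ℝ) ≤ √x := Nat.floor_le (Real.sqrt_nonneg _)
  rw [Nat.card_Ioc, tsub_zero] at hcard
  have hcard' : (((Finset.Icc 1 x).filter
      (fun n => (omegaCount n : ℝ) ≥ c * Real.log (Real.log n))).card : ℝ) ≤
      √x + 3 * (x * S) / (b * ℓ) ^ 2 := by
    refine (Nat.cast_le.2 hcard).trans ?_
    push_cast
    exact add_le_add hfloor hcheb
  rw [div_le_iff₀ hxpos]
  refine hcard'.trans ?_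
  rw [add_mul]
  refine add_le_add (le_of_eq ?_) ?_
  · rw [eq_inv_mul_iff_mul_eq₀ (Real.sqrt_pos.2 hxpos).ne', Real.mul_self_sqrt hxpos.le]
  · calc 3 * (x * S) / (b * ℓ) ^ 2 ≤ 3 * (x * (c * ℓ)) / (b * ℓ) ^ 2 := by gcongr
      _ = 3 * c / b ^ 2 / ℓ * x := by field_simp

/-- For 2 < γ < e, the set {n : ω(n) ≥ log log n / log γ} has density 0. -/
theorem omega_large_density_zero (γ : ℝ) (hγ2 : 2 < γ) (hγe : γ < Real.exp 1) :
    Tendsto (fun x : ℕ =>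
        (((Finset.Icc 1 x).filter
          (fun n => (omegaCount n : ℝ) ≥ Real.log (Real.log n) / Real.log γ)).card : ℝ) / (x : ℝ))
      atTop (nhds 0) := by
  have hlog0 : 0 < Real.log γ := Real.log_pos (by linarith)
  have hlog1 : Real.log γ < 1 := (Real.log_lt_iff_lt_exp (by linarith)).2 hγe
  simpa only [div_eq_inv_mul (Real.log (Real.log _))] using
    tendsto_card_omegaCount_ge_div ((one_lt_inv₀ hlog0).2 hlog1)
end

section
/- Let γ be a real number with 2 < γ < e. There exist positive constants c₀ (depending on γ) and C₂ such that for all real x > 1 and each natural number k with k < (log log x)/(log γ), the number of positive integers n ≤ x with log p_k(n) > γ^{−k} log x is at most C₂ · x · e^{−c₀ k}. -/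
open Polynomial Filter
open scoped Classical

open Finset in
lemma sum_log_div_prime_le {N : ℕ} (hN : 1 ≤ N) :
    ∑ p ∈ Nat.primesLE N, Real.log p / p ≤ Real.log N + Real.log 4 := by
  have hN0 : (0 : ℝ) < N := by exact_mod_cast hN
  have h_fact : Real.log (N.factorial : ℝ) =
      ∑ p ∈ Nat.primesLE N, (N.factorial.factorization p : ℝ) * Real.log p := by
    rw [Real.log_nat_eq_sum_factorization]
    refine Finsupp.sum_of_support_subset _ (fun p hp => ?_) _ (by simp)
    rw [Nat.support_factorization, Nat.mem_primeFactors] at hp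
    exact Nat.mem_primesLE.2 ⟨(hp.1.dvd_factorial).1 hp.2.1, hp.1⟩
  have h_upper : Real.log (N.factorial : ℝ) ≤ N * Real.log N := by
    rw [← Real.log_pow]
    exact Real.log_le_log (by exact_mod_cast N.factorial_pos)
      (by exact_mod_cast N.factorial_le_pow)
  have h_lower : ∑ p ∈ Nat.primesLE N, ((N : ℝ) * (Real.log p / p) - Real.log p) ≤
      Real.log (N.factorial : ℝ) := by
    rw [h_fact]
    refine sum_le_sum fun p hp => ?_
    have hpp := Nat.prime_of_mem_primesLE hp
    have h_val : N / p ≤ N.factorial.factorization p := by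
      have h1 := Nat.factorization_factorial_mul (n := N / p) hpp
      have h2 : (p * (N / p)).factorial ∣ N.factorial :=
        Nat.factorial_dvd_factorial (Nat.mul_div_le N p)
      have h3 := (Nat.factorization_le_iff_dvd (Nat.factorial_ne_zero _)
        (Nat.factorial_ne_zero _)).2 h2 p
      omega
    have h_floor : (N : ℝ) / p - 1 ≤ (N / p : ℕ) := by
      have := Nat.lt_floor_add_one ((N : ℝ) / p)
      rw [Nat.floor_div_eq_div] at this
      linarith
    have h_val' : ((N / p : ℕ) : ℝ) ≤ N.factorial.factorization p := by exact_mod_cast h_val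
    have h_log : 0 ≤ Real.log p := Real.log_natCast_nonneg p
    calc (N : ℝ) * (Real.log p / p) - Real.log p = ((N : ℝ) / p - 1) * Real.log p := by ring
      _ ≤ _ := mul_le_mul_of_nonneg_right (h_floor.trans h_val') h_log
  rw [sum_sub_distrib, ← mul_sum, ← Chebyshev.theta_eq_sum_primesLE_log] at h_lower
  have h_theta := Chebyshev.theta_le_log4_mul_x hN0.le
  refine le_of_mul_le_mul_left ?_ hN0
  linarith

lemma tsum_nat_rpow_inv_le {s : ℝ} (hs : 1 < s) :
    ∑' n : ℕ, ((n : ℝ) ^ s)⁻¹ ≤ 1 + 1 / (s - 1) := by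
  have h := ZetaAsymptotics.zeta_limit_aux1 hs
  have h0 : 0 ≤ ZetaAsymptotics.termTSum s :=
    tsum_nonneg fun n => ZetaAsymptotics.term_nonneg _ _
  rw [(Real.summable_nat_rpow_inv.2 hs).tsum_eq_zero_add]
  have hs0 : 0 ≤ s * ZetaAsymptotics.termTSum s := by positivity
  have h1 : ((0 : ℕ) : ℝ) ^ s = 0 := by
    rw [Nat.cast_zero, Real.zero_rpow (by linarith)]
  rw [h1, inv_zero, zero_add]
  simp only [one_div, Nat.cast_add, Nat.cast_one] at h ⊢
  linarith

lemma sum_prime_rpow_inv_le {s : ℝ} (hs : 1 < s) (N : ℕ) :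
    ∑ p ∈ Nat.primesLE N, ((p : ℝ) ^ s)⁻¹ ≤ Real.log (1 + 1 / (s - 1)) := by
  let f : ℕ →* ℝ :=
    { toFun := fun n => ((n : ℝ) ^ s)⁻¹
      map_one' := by simp
      map_mul' := fun m n => by
        rw [Nat.cast_mul, Real.mul_rpow (Nat.cast_nonneg m) (Nat.cast_nonneg n), mul_inv] }
  have hf_sum : Summable f := Real.summable_nat_rpow_inv.2 hs
  have hf_nonneg (n : ℕ) : 0 ≤ f n := by
    change 0 ≤ ((n : ℝ) ^ s)⁻¹
    positivity
  have hf_lt {p : ℕ} (hp : p.Prime) : f p < 1 :=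
    (le_abs_self _).trans_lt (hf_sum.norm_lt_one hp.one_lt)
  have h_prod : ∏ p ∈ Nat.primesLE N, (1 - f p)⁻¹ ≤ 1 + 1 / (s - 1) := by
    rw [Nat.primesLE, EulerProduct.prod_primesBelow_geometric_eq_tsum_smoothNumbers hf_sum]
    exact (hf_sum.tsum_subtype_le f _ hf_nonneg).trans (tsum_nat_rpow_inv_le hs)
  have h_pos : ∀ p ∈ Nat.primesLE N, 0 < (1 - f p)⁻¹ := fun p hp =>
    inv_pos.2 (sub_pos.2 (hf_lt (Nat.prime_of_mem_primesLE hp)))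
  refine le_trans ?_ (Real.log_le_log (Finset.prod_pos h_pos) h_prod)
  rw [Real.log_prod fun p hp => (h_pos p hp).ne']
  refine Finset.sum_le_sum fun p hp => ?_
  rw [Real.log_inv]
  have := Real.log_le_sub_one_of_pos (inv_pos.1 (h_pos p hp))
  change f p ≤ _
  linarith

lemma sum_prime_inv_le {x : ℝ} (hx : Real.exp 1 ≤ x) :
    ∑ p ∈ Nat.primesLE ⌊x⌋₊, (p : ℝ)⁻¹ ≤ Real.log (Real.log x) + (1 + 3 * Real.log 2) := by
  have hx0 : 0 < x := (Real.exp_pos 1).trans_le hx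
  have hx1 : 1 ≤ x := (Real.one_le_exp zero_le_one).trans hx
  have hL : 1 ≤ Real.log x := (Real.le_log_iff_exp_le hx0).2 hx
  have hN : 1 ≤ ⌊x⌋₊ := Nat.one_le_floor_iff x |>.2 hx1
  set δ : ℝ := (Real.log x)⁻¹ with hδ
  have hδ0 : 0 < δ := inv_pos.2 (by linarith)
  have h_term : ∀ p ∈ Nat.primesLE ⌊x⌋₊,
      (p : ℝ)⁻¹ ≤ ((p : ℝ) ^ (1 + δ))⁻¹ + δ * (Real.log p / p) := by
    intro p hp
    have hp0 : (0 : ℝ) < p := by exact_mod_cast (Nat.prime_of_mem_primesLE hp).pos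
    have h1 : ((p : ℝ) ^ (1 + δ))⁻¹ = (p : ℝ)⁻¹ * Real.exp (-(δ * Real.log p)) := by
      rw [Real.rpow_add hp0, Real.rpow_one, mul_inv, Real.rpow_def_of_pos hp0, ← Real.exp_neg,
        mul_comm δ]
    have h2 := Real.add_one_le_exp (-(δ * Real.log p))
    have h3 : (p : ℝ)⁻¹ * (1 - δ * Real.log p) ≤ (p : ℝ)⁻¹ * Real.exp (-(δ * Real.log p)) :=
      mul_le_mul_of_nonneg_left (by linarith) (by positivity)
    rw [h1]
    have h4 : δ * (Real.log p / p) = (p : ℝ)⁻¹ * (δ * Real.log p) := by ring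
    linarith
  have h_sum := Finset.sum_le_sum h_term
  rw [Finset.sum_add_distrib, ← Finset.mul_sum] at h_sum
  have h_zeta := sum_prime_rpow_inv_le (show 1 < 1 + δ by linarith) ⌊x⌋₊
  have h_eq : 1 + 1 / (1 + δ - 1) = 1 + Real.log x := by
    rw [add_sub_cancel_left, hδ, one_div, inv_inv]
  have h_log : Real.log (1 + Real.log x) ≤ Real.log 2 + Real.log (Real.log x) := by
    rw [← Real.log_mul (by norm_num) (by linarith)]
    exact Real.log_le_log (by linarith) (by linarith)
  have h_floor : Real.log ⌊x⌋₊ ≤ Real.log x :=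
    Real.log_le_log (by exact_mod_cast hN) (Nat.floor_le hx0.le)
  have h_four : Real.log 4 = 2 * Real.log 2 := by
    rw [show (4 : ℝ) = 2 ^ 2 by norm_num, Real.log_pow]; norm_num
  have h_two : 0 < Real.log 2 := Real.log_pos (by norm_num)
  have h_mertens : δ * ∑ p ∈ Nat.primesLE ⌊x⌋₊, Real.log p / p ≤ 1 + 2 * Real.log 2 := by
    have h1 := (sum_log_div_prime_le hN).trans (add_le_add_left h_floor _)
    calc _ ≤ δ * (Real.log x + 2 * Real.log 2) :=
          mul_le_mul_of_nonneg_left (by linarith) hδ0.le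
      _ = 1 + δ * (2 * Real.log 2) := by rw [mul_add, hδ, inv_mul_cancel₀ (by linarith)]
      _ ≤ _ := by
        have : δ ≤ 1 := inv_le_one_of_one_le₀ hL
        nlinarith
  rw [h_eq] at h_zeta
  linarith

lemma sum_inv_mul_pred_le_one (N : ℕ) :
    ∑ n ∈ Finset.Icc 2 N, ((n : ℝ) * (n - 1))⁻¹ ≤ 1 := by
  rcases Nat.eq_zero_or_pos N with rfl | hN
  · simp
  have h : ∑ n ∈ Finset.Icc 2 N, ((n : ℝ) * (n - 1))⁻¹ = 1 - (N : ℝ)⁻¹ := by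
    induction N, hN using Nat.le_induction with
    | base => simp
    | succ N hN ih =>
      have hN0 : (0 : ℝ) < N := by exact_mod_cast hN
      rw [Finset.sum_Icc_succ_top (by omega), ih]
      push_cast
      rw [add_sub_cancel_right]
      field_simp
      ring
  rw [h]
  have : (0 : ℝ) ≤ (N : ℝ)⁻¹ := by positivity
  linarith

lemma le_sum_prime_inv {t : ℝ} (ht : 1 < t) :
    Real.log (Real.log t) - 1 ≤ ∑ p ∈ Nat.primesLE ⌊t⌋₊, (p : ℝ)⁻¹ := by
  let f : ℕ →* ℝ :=
    { toFun := fun n => (n : ℝ)⁻¹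
      map_one' := by simp
      map_mul' := fun m n => by rw [Nat.cast_mul, mul_inv] }
  have hf_nonneg (n : ℕ) : 0 ≤ f n := by
    change 0 ≤ (n : ℝ)⁻¹
    positivity
  have hf_lt {p : ℕ} (hp : p.Prime) : f p < 1 :=
    inv_lt_one_of_one_lt₀ (by exact_mod_cast hp.one_lt)
  obtain ⟨-, h_hasSum⟩ :=
    EulerProduct.summable_and_hasSum_smoothNumbers_prod_primesBelow_geometric (f := f)
      (fun hp => by rw [Real.norm_of_nonneg (hf_nonneg _)]; exact hf_lt hp) (⌊t⌋₊ + 1)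
  have h_harm : Real.log t ≤ ∏ p ∈ Nat.primesLE ⌊t⌋₊, (1 - f p)⁻¹ := by
    refine (log_le_harmonic_floor t (by linarith)).trans ?_
    rw [harmonic_eq_sum_Icc]
    push_cast
    have h_mem : ∀ n ∈ Finset.Icc 1 ⌊t⌋₊, n ∈ Nat.smoothNumbers (⌊t⌋₊ + 1) := fun n hn => by
      rw [Finset.mem_Icc] at hn
      exact Nat.mem_smoothNumbers_of_lt (by omega) (by omega)
    rw [← Finset.sum_subtype_of_mem (fun n : ℕ => (n : ℝ)⁻¹) h_mem]
    exact sum_le_hasSum _ (fun n _ => hf_nonneg n) h_hasSum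
  have h_pos : ∀ p ∈ Nat.primesLE ⌊t⌋₊, 0 < (1 - f p)⁻¹ := fun p hp =>
    inv_pos.2 (sub_pos.2 (hf_lt (Nat.prime_of_mem_primesLE hp)))
  have h_log := Real.log_le_log (Real.log_pos ht) h_harm
  rw [Real.log_prod fun p hp => (h_pos p hp).ne'] at h_log
  have h_term : ∀ p ∈ Nat.primesLE ⌊t⌋₊,
      Real.log (1 - f p)⁻¹ ≤ (p : ℝ)⁻¹ + ((p : ℝ) * (p - 1))⁻¹ := fun p hp => by
    refine (Real.log_le_sub_one_of_pos (h_pos p hp)).trans_eq ?_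
    have hp1 : (1 : ℝ) < p := by exact_mod_cast (Nat.prime_of_mem_primesLE hp).one_lt
    have : (p : ℝ) - 1 ≠ 0 := by linarith
    change (1 - (p : ℝ)⁻¹)⁻¹ - 1 = _
    field_simp
    ring
  have h_sum := Finset.sum_le_sum h_term
  rw [Finset.sum_add_distrib] at h_sum
  have h_tail : ∑ p ∈ Nat.primesLE ⌊t⌋₊, ((p : ℝ) * (p - 1))⁻¹ ≤ 1 := by
    refine le_trans (Finset.sum_le_sum_of_subset_of_nonneg ?_ fun n hn _ => ?_)
      (sum_inv_mul_pred_le_one ⌊t⌋₊)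
    · rw [Nat.primesLE_eq_filter_Icc_two]
      exact Finset.filter_subset _ _
    · have : (2 : ℝ) ≤ n := by exact_mod_cast (Finset.mem_Icc.1 hn).1
      exact inv_nonneg.2 (mul_nonneg (by linarith) (by linarith))
  linarith

lemma sum_prime_inv_sdiff_le {t x : ℝ} (ht : 1 < t) (htx : t ≤ x) (hx : Real.exp 1 ≤ x) :
    ∑ p ∈ Nat.primesLE ⌊x⌋₊ \ Nat.primesLE ⌊t⌋₊, (p : ℝ)⁻¹ ≤
      Real.log (Real.log x / Real.log t) + (2 + 3 * Real.log 2) := by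
  have h_sub : Nat.primesLE ⌊t⌋₊ ⊆ Nat.primesLE ⌊x⌋₊ :=
    Nat.primesLE_mono (Nat.floor_le_floor htx)
  have h := Finset.sum_sdiff (f := fun p : ℕ => (p : ℝ)⁻¹) h_sub
  rw [Real.log_div (Real.log_pos (ht.trans_le htx)).ne' (Real.log_pos ht).ne']
  have h_upper := sum_prime_inv_le hx
  have h_lower := le_sum_prime_inv ht
  linarith

open Finset in
lemma sum_pow_card_primeFactors_inter_le (S : Finset ℕ) (hS : ∀ p ∈ S, p.Prime) {z : ℝ}
    (hz : 1 ≤ z) (N : ℕ) :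
    ∑ n ∈ Icc 1 N, z ^ #(n.primeFactors ∩ S) ≤
      N * Real.exp ((z - 1) * ∑ p ∈ S, (p : ℝ)⁻¹) := by
  have h_expand (n : ℕ) : z ^ #(n.primeFactors ∩ S) =
      ∑ U ∈ S.powerset, if U ⊆ n.primeFactors then (z - 1) ^ #U else 0 := by
    rw [← sum_filter]
    have h_powerset : S.powerset.filter (· ⊆ n.primeFactors) =
        (n.primeFactors ∩ S).powerset := by
      ext U
      simp only [mem_filter, mem_powerset, subset_inter_iff]
      exact and_comm
    have h_prod := prod_one_add (f := fun _ : ℕ => z - 1) (n.primeFactors ∩ S)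
    simp only [prod_const, add_sub_cancel] at h_prod
    rw [h_powerset, h_prod]
  simp_rw [h_expand]
  rw [sum_comm]
  have h_term : ∀ U ∈ S.powerset,
      (∑ n ∈ Icc 1 N, if U ⊆ n.primeFactors then (z - 1) ^ #U else 0) ≤
        N * ∏ p ∈ U, (z - 1) * (p : ℝ)⁻¹ := by
    intro U hU
    have hU_prime : ∀ p ∈ U, p.Prime := fun p hp => hS p (mem_powerset.1 hU hp)
    rw [← sum_filter, sum_const, nsmul_eq_mul, prod_mul_distrib, prod_const, prod_inv_distrib]
    have h_sub : (Icc 1 N).filter (fun n => U ⊆ n.primeFactors) ⊆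
        (Ioc 0 N).filter (fun n => (∏ p ∈ U, p) ∣ n) := by
      intro n hn
      rw [mem_filter, mem_Icc] at hn
      rw [mem_filter, mem_Ioc]
      refine ⟨⟨by omega, hn.1.2⟩, prod_primes_dvd n (fun p hp => (hU_prime p hp).prime)
        fun p hp => Nat.dvd_of_mem_primeFactors (hn.2 hp)⟩
    have h_card := card_le_card h_sub
    have h_card_eq : #((Ioc 0 N).filter (fun n => (∏ p ∈ U, p) ∣ n)) = N / ∏ p ∈ U, p := by
      convert Nat.Ioc_filter_dvd_card_eq_div N (∏ p ∈ U, p)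
    rw [h_card_eq] at h_card
    have h_card' : (#((Icc 1 N).filter (fun n => U ⊆ n.primeFactors)) : ℝ) ≤
        N * (∏ p ∈ U, (p : ℝ))⁻¹ := by
      refine (Nat.cast_le.2 h_card).trans (Nat.cast_div_le.trans_eq ?_)
      push_cast
      rw [div_eq_mul_inv]
    calc _ ≤ N * (∏ p ∈ U, (p : ℝ))⁻¹ * (z - 1) ^ #U :=
          mul_le_mul_of_nonneg_right h_card' (pow_nonneg (by linarith) _)
      _ = _ := by ring
  refine (sum_le_sum h_term).trans ?_
  rw [← mul_sum, ← prod_one_add, mul_sum]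
  refine mul_le_mul_of_nonneg_left (Real.prod_one_add_le_exp_sum _ fun p => ?_) (Nat.cast_nonneg N)
  exact mul_nonneg (by linarith) (by positivity)

open Finset in
lemma le_card_primeFactors_of_lt_pk {n k m : ℕ} (hk : 1 ≤ k) (hm : 1 ≤ m) (h : m < pk n k) :
    k ≤ #(n.primeFactors.filter (m < ·)) := by
  unfold pk at h
  split_ifs at h with hkn
  · set l := n.primeFactors.sort (· ≤ ·)
    have hlen : l.length = #n.primeFactors := length_sort _
    have h_sorted : l.SortedLE := (pairwise_sort _ _).sortedLE
    rw [List.getD_eq_getElem _ _ (by omega)] at h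
    have h_sub : (l.drop (#n.primeFactors - k)).toFinset ⊆ n.primeFactors.filter (m < ·) := by
      intro q hq
      rw [List.mem_toFinset] at hq
      rw [mem_filter]
      refine ⟨(mem_sort (· ≤ ·)).1 (List.mem_of_mem_drop hq), ?_⟩
      obtain ⟨i, hi, rfl⟩ := List.mem_iff_getElem.1 hq
      rw [List.getElem_drop]
      refine h.trans_le (h_sorted.getElem_le_getElem_of_le (Nat.le_add_right _ _))
    have h_card := card_le_card h_sub
    rw [List.toFinset_card_of_nodup ((sort_nodup _ _).sublist (List.drop_sublist _ _)),
      List.length_drop] at h_card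
    change l.length - _ ≤ _ at h_card
    omega
  · omega

/-- For 2 < γ < e there are positive constants c₀(γ), C₂ such that for
all x > 1 and each natural number k with k < log log x / log γ,
#{n ≤ x : log p_k(n) > γ^{-k} log x} ≤ C₂ x e^{-c₀ k}. -/
theorem count_large_kth_prime_factor (γ : ℝ) (hγ2 : 2 < γ) (hγe : γ < Real.exp 1) :
    ∃ c₀ C₂ : ℝ, 0 < c₀ ∧ 0 < C₂ ∧
      ∀ x : ℝ, 1 < x → ∀ k : ℕ, 1 ≤ k →
        (k : ℝ) < Real.log (Real.log x) / Real.log γ →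
        (((Finset.Icc 1 ⌊x⌋₊).filter
            (fun n => Real.log (pk n k) > γ ^ (-(k : ℤ)) * Real.log x)).card : ℝ)
          ≤ C₂ * x * Real.exp (-(c₀ * k)) := by
  have hγ0 : 0 < γ := by linarith
  have hγ1 : 1 < γ := by linarith
  set L := Real.log γ with hL
  have hL0 : 0 < L := Real.log_pos hγ1
  have hL1 : L < 1 := (Real.log_lt_iff_lt_exp hγ0).2 hγe
  have hz : 1 ≤ L⁻¹ := (one_le_inv₀ hL0).2 hL1.le
  have h_rate := Real.log_lt_sub_one_of_pos hL0 hL1.ne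
  refine ⟨L - 1 - Real.log L, Real.exp ((L⁻¹ - 1) * (2 + 3 * Real.log 2)), by linarith,
    Real.exp_pos _, fun x hx k hk hkx => ?_⟩
  have hlogx : 0 < Real.log x := Real.log_pos hx
  have h_pow : γ ^ k < Real.log x := by
    rw [lt_div_iff₀ hL0, hL, ← Real.log_pow] at hkx
    exact (Real.log_lt_log_iff (by positivity) hlogx).1 hkx
  have hγk : 1 ≤ γ ^ k := one_le_pow₀ hγ1.le
  have hx_exp : Real.exp 1 ≤ x :=
    (Real.le_log_iff_exp_le (by linarith)).1 (hγk.trans h_pow.le)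
  set u : ℝ := γ ^ (-(k : ℤ)) * Real.log x with hu
  have hu_eq : u = Real.log x / γ ^ k := by
    rw [hu, zpow_neg, zpow_natCast, inv_mul_eq_div]
  have hu1 : 1 < u := by rwa [hu_eq, one_lt_div (by positivity)]
  set t : ℝ := Real.exp u with ht
  have ht1 : 1 < t := Real.one_lt_exp_iff.2 (by linarith)
  have htx : t ≤ x := by
    rw [ht, ← Real.le_log_iff_exp_le (by linarith), hu_eq]
    exact div_le_self hlogx.le hγk
  have h_mertens := sum_prime_inv_sdiff_le ht1 htx hx_exp
  have h_ratio : Real.log (Real.log x / Real.log t) = k * L := by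
    rw [ht, Real.log_exp, hu_eq, div_div_cancel₀ hlogx.ne', Real.log_pow]
  rw [h_ratio] at h_mertens
  set S := Nat.primesLE ⌊x⌋₊ \ Nat.primesLE ⌊t⌋₊ with hS
  have h_moment := sum_pow_card_primeFactors_inter_le S
    (fun p hp => Nat.prime_of_mem_primesLE (Finset.mem_sdiff.1 hp).1) hz ⌊x⌋₊
  set F := (Finset.Icc 1 ⌊x⌋₊).filter (fun n => Real.log (pk n k) > u) with hF
  have h_many : ∀ n ∈ F, L⁻¹ ^ k ≤ L⁻¹ ^ (n.primeFactors ∩ S).card := by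
    intro n hn
    rw [hF, Finset.mem_filter, Finset.mem_Icc] at hn
    obtain ⟨⟨hn1, hnx⟩, hpk⟩ := hn
    refine pow_le_pow_right₀ hz ?_
    have hpk_pos : (0 : ℝ) < pk n k := by
      rcases (Nat.cast_nonneg (α := ℝ) (pk n k)).eq_or_lt with h0 | h0
      · rw [← h0, Real.log_zero] at hpk
        linarith
      · exact h0
    have h_lt : ⌊t⌋₊ < pk n k :=
      (Nat.floor_lt (by linarith)).2 ((Real.lt_log_iff_exp_lt hpk_pos).1 hpk)
    refine (le_card_primeFactors_of_lt_pk hk (Nat.one_le_floor_iff t |>.2 ht1.le) h_lt).trans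
      (Finset.card_le_card fun p hp => ?_)
    rw [Finset.mem_filter] at hp
    rw [Finset.mem_inter, hS, Finset.mem_sdiff, Nat.mem_primesLE, Nat.mem_primesLE]
    have hp_le := Nat.le_of_mem_primeFactors hp.1
    exact ⟨hp.1, ⟨hp_le.trans hnx, Nat.prime_of_mem_primeFactors hp.1⟩, fun h => by omega⟩
  have h_markov : (F.card : ℝ) * L⁻¹ ^ k ≤
      x * Real.exp ((L⁻¹ - 1) * (k * L + (2 + 3 * Real.log 2))) := by
    calc (F.card : ℝ) * L⁻¹ ^ k = ∑ n ∈ F, L⁻¹ ^ k := by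
          rw [Finset.sum_const, nsmul_eq_mul]
      _ ≤ ∑ n ∈ F, L⁻¹ ^ (n.primeFactors ∩ S).card := Finset.sum_le_sum h_many
      _ ≤ ∑ n ∈ Finset.Icc 1 ⌊x⌋₊, L⁻¹ ^ (n.primeFactors ∩ S).card :=
          Finset.sum_le_sum_of_subset_of_nonneg (Finset.filter_subset _ _)
            fun n _ _ => by positivity
      _ ≤ ⌊x⌋₊ * Real.exp ((L⁻¹ - 1) * ∑ p ∈ S, (p : ℝ)⁻¹) := by convert h_moment
      _ ≤ _ := by
          have h_nonneg : 0 ≤ L⁻¹ - 1 := by linarith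
          have h_floor : (⌊x⌋₊ : ℝ) ≤ x := Nat.floor_le (by linarith)
          gcongr
  have h_exp : L⁻¹ ^ k = Real.exp (-(k * Real.log L)) := by
    rw [Real.exp_neg, Real.exp_nat_mul, Real.exp_log hL0, inv_pow]
  rw [← le_div_iff₀ (by positivity), h_exp, mul_div_assoc, ← Real.exp_sub] at h_markov
  refine h_markov.trans_eq ?_
  rw [mul_comm (Real.exp _) x, mul_assoc, ← Real.exp_add]
  congr 2
  field_simp
  ring
end
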